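/- Let Ω ⊂ ℝ² be open. Then every weakly monotone function u ∈ W^{1,1}_loc(Ω) is locally essentially bounded and admits a representative whose restriction to the complement in Ω of a set of C_{Ψ,1}-capacity zero is continuous, where Ψ(t) = t (i.e. the exceptional set has C_{1,1}-capacity zero in the classical Riesz capacity scale). -/

import Mathlib

open MeasureTheory Metric Set Filter ENNReal
open scoped Topology NNReal

noncomputable section

/-- Euclidean space `ℝⁿ`. -/
abbrev Euc (n : ℕ) : Type := EuclideanSpace ℝ (Fin n)

/-- A Young function: a convex function `A : [0,∞) → [0,∞]` with `A 0 = 0`,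
not constant on `(0,∞)`.  (Only values on `[0,∞)` are relevant.) -/
def IsYoung (A : ℝ → ℝ≥0∞) : Prop :=
  A 0 = 0 ∧
    (∀ ⦃x y : ℝ⦄, 0 ≤ x → 0 ≤ y → ∀ ⦃l : ℝ⦄, 0 ≤ l → l ≤ 1 →
      A (l * x + (1 - l) * y) ≤ ENNReal.ofReal l * A x + ENNReal.ofReal (1 - l) * A y) ∧
    ∃ x y : ℝ, 0 < x ∧ 0 < y ∧ A x ≠ A y

/-- The Young conjugate `Ã(t) = sup { s·t − A(s) : s ≥ 0 }`. -/
def youngConj (A : ℝ → ℝ≥0∞) (t : ℝ) : ℝ≥0∞ :=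
  ⨆ s : Ici (0 : ℝ), (ENNReal.ofReal ((s : ℝ) * t) - A s)

/-- The exponent `(n-1)/(n-2)`. -/
def youngExp (n : ℕ) : ℝ := ((n : ℝ) - 1) / ((n : ℝ) - 2)

/-- The Young function `A_{n-1}`; equal to `A` for `n = 2`, and for `n ≥ 3` the
Young conjugate of `t ↦ t^{(n-1)/(n-2)} ∫_t^∞ Ã(r) r^{-1-(n-1)/(n-2)} dr`. -/
def youngShifted (n : ℕ) (A : ℝ → ℝ≥0∞) : ℝ → ℝ≥0∞ :=
  if n = 2 then A
  else youngConj fun t =>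
    ENNReal.ofReal (t ^ youngExp n) *
      ∫⁻ r in Ioi t, youngConj A r / ENNReal.ofReal (r ^ (1 + youngExp n))

/-- The generalized right-continuous inverse of a Young function. -/
def youngInv (A : ℝ → ℝ≥0∞) (τ : ℝ≥0∞) : ℝ≥0∞ :=
  ⨅ (s : ℝ) (_ : 0 ≤ s ∧ τ < A s), ENNReal.ofReal s

/-- The condition `∫^∞ (t/A(t))^{1/(n-2)} dt < ∞`. -/
def TailCondition (n : ℕ) (A : ℝ → ℝ≥0∞) : Prop :=
  ∃ t₀ : ℝ, 0 < t₀ ∧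
    ∫⁻ t in Ioi t₀, (ENNReal.ofReal t / A t) ^ (1 / ((n : ℝ) - 2)) < ∞

/-- The Δ₂-condition near infinity. -/
def Delta2Infty (A : ℝ → ℝ≥0∞) : Prop :=
  ∃ C : ℝ, 2 < C ∧ ∃ t₀ : ℝ, 0 ≤ t₀ ∧ ∀ t : ℝ, t₀ ≤ t → A (2 * t) ≤ ENNReal.ofReal C * A t

/-- `g` is the weak gradient of `u` on the open set `Ω`, with `u` and `g`
locally integrable on `Ω`. -/
def IsWeakGradOn {n : ℕ} (Ω : Set (Euc n)) (u : Euc n → ℝ) (g : Euc n → Euc n) : Prop :=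
  LocallyIntegrableOn u Ω volume ∧ LocallyIntegrableOn (fun x => ‖g x‖) Ω volume ∧
    ∀ φ : Euc n → ℝ, ContDiff ℝ (⊤ : ℕ∞) φ → HasCompactSupport φ → tsupport φ ⊆ Ω →
      ∀ i : Fin n,
        ∫ x, u x * fderiv ℝ φ x (EuclideanSpace.single i 1) = - ∫ x, g x i * φ x

/-- Membership in the Orlicz space `L^A(s)` (finiteness of the Luxemburg norm). -/
def MemOrliczOn {n : ℕ} (A : ℝ → ℝ≥0∞) (s : Set (Euc n)) (f : Euc n → ℝ) : Prop :=
  ∃ lam : ℝ, 0 < lam ∧ ∫⁻ x in s, A (|f x| / lam) < ∞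

/-- `u ∈ W^{1,A}_loc(Ω)`, with weak gradient `g`. -/
def MemW1Aloc {n : ℕ} (A : ℝ → ℝ≥0∞) (Ω : Set (Euc n)) (u : Euc n → ℝ)
    (g : Euc n → Euc n) : Prop :=
  IsWeakGradOn Ω u g ∧
    ∀ Ω' : Set (Euc n), IsOpen Ω' → IsCompact (closure Ω') → closure Ω' ⊆ Ω →
      MemOrliczOn A Ω' u ∧ MemOrliczOn A Ω' (fun x => ‖g x‖)

/-- `v ∈ W^{1,1}_0(Ω')`: `v` has a weak gradient on `Ω'` and is approximable in the
`W^{1,1}(Ω')` norm by smooth functions compactly supported in `Ω'`. -/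
def MemW110 {n : ℕ} (Ω' : Set (Euc n)) (v : Euc n → ℝ) : Prop :=
  ∃ h : Euc n → Euc n, IsWeakGradOn Ω' v h ∧
    ∃ φ : ℕ → Euc n → ℝ,
      (∀ k, ContDiff ℝ (⊤ : ℕ∞) (φ k) ∧ HasCompactSupport (φ k) ∧ tsupport (φ k) ⊆ Ω') ∧
      Tendsto (fun k => ∫ x in Ω', (|φ k x - v x| + ‖gradient (φ k) x - h x‖))
        atTop (𝓝 0)

/-- `u` is weakly monotone on `Ω`. -/
def WeaklyMonotone {n : ℕ} (Ω : Set (Euc n)) (u : Euc n → ℝ) : Prop :=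
  ∀ Ω' : Set (Euc n), IsOpen Ω' → IsCompact (closure Ω') → closure Ω' ⊆ Ω →
    ∀ m M : ℝ, m ≤ M →
      MemW110 Ω' (fun x => max (u x - M) 0 - max (m - u x) 0) →
      ∀ᵐ x ∂volume.restrict Ω', m ≤ u x ∧ u x ≤ M

/-- The essential oscillation of `u` on a set `s`. -/
def essOsc {n : ℕ} (s : Set (Euc n)) (u : Euc n → ℝ) : ℝ≥0∞ :=
  essSup (fun p : Euc n × Euc n => ENNReal.ofReal |u p.1 - u p.2|)
    ((volume.restrict s).prod (volume.restrict s))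

/-- The Riesz-type kernel `1 / (|x-y|ⁿ Ψ(1/|x-y|))`. -/
def rieszKernel {n : ℕ} (Ψ : ℝ → ℝ≥0∞) (x y : Euc n) : ℝ≥0∞ :=
  (ENNReal.ofReal (‖x - y‖ ^ n) * Ψ (1 / ‖x - y‖))⁻¹

/-- The Riesz-type potential `I_Ψ f`. -/
def rieszPot {n : ℕ} (Ψ : ℝ → ℝ≥0∞) (f : Euc n → ℝ≥0∞) (x : Euc n) : ℝ≥0∞ :=
  ∫⁻ y, f y * rieszKernel Ψ x y

/-- The capacity `C_{Ψ,1}`. -/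
def capPsi {n : ℕ} (Ψ : ℝ → ℝ≥0∞) (E : Set (Euc n)) : ℝ≥0∞ :=
  ⨅ (f : Euc n → ℝ≥0∞) (_ : Measurable f) (_ : ∀ x ∈ E, 1 ≤ rieszPot Ψ f x),
    ∫⁻ x, f x



section approximation

lemma tendsto_lintegral_enorm_sub_of_ae {α E : Type*} [MeasurableSpace α] {μ : Measure α}
    [NormedAddCommGroup E] {F : ℕ → α → E} {f : α → E} (hF : ∀ j, Integrable (F j) μ)
    (hf : Integrable f μ) (hae : ∀ᵐ x ∂μ, Tendsto (fun j => F j x) atTop (𝓝 (f x)))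
    (hle : ∀ j, ∫ x, ‖F j x‖ ∂μ ≤ ∫ x, ‖f x‖ ∂μ) :
    Tendsto (fun j => ∫⁻ x, ‖F j x - f x‖ₑ ∂μ) atTop (𝓝 0) := by
  have hlim : Tendsto (fun j => ∫ x, (‖F j x - f x‖ - (‖F j x‖ - ‖f x‖)) ∂μ) atTop (𝓝 0) := by
    have := tendsto_integral_of_dominated_convergence (μ := μ)
      (F := fun j x => ‖F j x - f x‖ - (‖F j x‖ - ‖f x‖)) (f := fun _ => (0 : ℝ))
      (fun x => 2 * ‖f x‖)
      (fun j => ((hF j).sub hf).norm.aestronglyMeasurable.sub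
        ((hF j).norm.sub hf.norm).aestronglyMeasurable) (hf.norm.const_mul 2) ?_ ?_
    · simpa using this
    · intro j
      refine .of_forall fun x => ?_
      rw [Real.norm_eq_abs, abs_le]
      have h1 := norm_sub_norm_le (F j x) (f x)
      have h2 := norm_sub_le (F j x) (f x)
      constructor <;> linarith [norm_nonneg (f x)]
    · filter_upwards [hae] with x hx
      have : Tendsto (fun j => ‖F j x - f x‖ - (‖F j x‖ - ‖f x‖)) atTop
          (𝓝 (‖f x - f x‖ - (‖f x‖ - ‖f x‖))) :=
        ((hx.sub_const _).norm).sub (hx.norm.sub_const _)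
      simpa using this
  have hint : Tendsto (fun j => ∫ x, ‖F j x - f x‖ ∂μ) atTop (𝓝 0) := by
    refine squeeze_zero (fun j => integral_nonneg fun x => norm_nonneg _) (fun j => ?_) hlim
    have h1 : ∫ x, (‖F j x - f x‖ - (‖F j x‖ - ‖f x‖)) ∂μ
        = ∫ x, ‖F j x - f x‖ ∂μ - ∫ x, (‖F j x‖ - ‖f x‖) ∂μ :=
      integral_sub ((hF j).sub hf).norm ((hF j).norm.sub hf.norm)
    rw [h1, integral_sub (hF j).norm hf.norm]
    linarith [hle j]
  have := (ENNReal.continuous_ofReal.tendsto 0).comp hint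
  rw [ENNReal.ofReal_zero] at this
  refine this.congr fun j => ?_
  exact ofReal_integral_norm_eq_lintegral_enorm ((hF j).sub hf)

open scoped Convolution in
lemma tendsto_lintegral_enorm_convolution_sub {G E : Type*} [NormedAddCommGroup G]
    [NormedSpace ℝ G] [FiniteDimensional ℝ G] [MeasurableSpace G] [BorelSpace G]
    (μ : Measure G) [μ.IsAddHaarMeasure] [NormedAddCommGroup E] [NormedSpace ℝ E] [CompleteSpace E]
    (ρ : ℕ → ContDiffBump (0 : G)) (hρ : Tendsto (fun j => (ρ j).rOut) atTop (𝓝 0))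
    (hK : ∀ j, (ρ j).rOut ≤ 2 * (ρ j).rIn) {f : G → E} (hf : Integrable f μ) :
    Tendsto (fun j => ∫⁻ x,
      ‖((ρ j).normed μ ⋆[ContinuousLinearMap.lsmul ℝ ℝ, μ] f) x - f x‖ₑ ∂μ) atTop (𝓝 0) := by
  have hρi : ∀ j, Integrable ((ρ j).normed μ) μ := fun j => (ρ j).integrable_normed
  refine tendsto_lintegral_enorm_sub_of_ae (fun j => (hρi j).integrable_convolution _ hf) hf
    (ContDiffBump.ae_convolution_tendsto_right_of_locallyIntegrable hρ (.of_forall hK)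
      hf.locallyIntegrable) fun j => ?_
  calc ∫ x, ‖((ρ j).normed μ ⋆[ContinuousLinearMap.lsmul ℝ ℝ, μ] f) x‖ ∂μ
      ≤ ∫ x, ((ρ j).normed μ ⋆[ContinuousLinearMap.lsmul ℝ ℝ, μ] fun y => ‖f y‖) x ∂μ := by
        refine integral_mono ((hρi j).integrable_convolution _ hf).norm
          ((hρi j).integrable_convolution _ hf.norm) fun x => ?_
        simp only [convolution_def]
        refine (norm_integral_le_integral_norm _).trans (le_of_eq (integral_congr_ae
          (.of_forall fun t => ?_)))
        simp [norm_smul, abs_of_nonneg ((ρ j).nonneg_normed t)]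
    _ = ∫ x, ‖f x‖ ∂μ := by
        rw [integral_convolution _ (hρi j) hf.norm]
        simp [(ρ j).integral_normed]

lemma gradient_apply_euc {n : ℕ} (f : Euc n → ℝ) (x : Euc n) (i : Fin n) :
    gradient f x i = fderiv ℝ f x (EuclideanSpace.single i 1) := by
  have h : inner ℝ (gradient f x) (EuclideanSpace.single i (1 : ℝ))
      = fderiv ℝ f x (EuclideanSpace.single i 1) := by
    simp [gradient]
  rw [← h, EuclideanSpace.inner_single_right]
  simp

open scoped Convolution in
lemma gradient_convolution_eq {n : ℕ} {Ω : Set (Euc n)} {u : Euc n → ℝ} {g : Euc n → Euc n}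
    (hu : IsWeakGradOn Ω u g) (ρ : ContDiffBump (0 : Euc n)) {K : Set (Euc n)}
    (hK : MeasurableSet K) (hKΩ : K ⊆ Ω) (hui : IntegrableOn u K) (hgi : IntegrableOn g K)
    {x : Euc n} (hx : closedBall x ρ.rOut ⊆ K) :
    gradient (ρ.normed volume ⋆[ContinuousLinearMap.lsmul ℝ ℝ, volume] K.indicator u) x
      = (ρ.normed volume ⋆[ContinuousLinearMap.lsmul ℝ ℝ, volume] K.indicator g) x := by
  have hu' : Integrable (K.indicator u) := hui.integrable_indicator hK
  have hg' : Integrable (K.indicator g) := hgi.integrable_indicator hK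
  have hd := (ρ.hasCompactSupport_normed (μ := volume)).hasFDerivAt_convolution_left
    (ContinuousLinearMap.lsmul ℝ ℝ) (μ := volume) ρ.contDiff_normed hu'.locallyIntegrable x
  have hex : ConvolutionExistsAt (fderiv ℝ (ρ.normed volume)) (K.indicator u) x
      ((ContinuousLinearMap.lsmul ℝ ℝ).precompL (Euc n)) volume :=
    (ρ.hasCompactSupport_normed.fderiv ℝ).convolutionExists_left _
      ((ρ.contDiff_normed (n := 1)).continuous_fderiv one_ne_zero) hu'.locallyIntegrable x
  have hex' : ConvolutionExistsAt (ρ.normed volume) (K.indicator g) x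
      (ContinuousLinearMap.lsmul ℝ ℝ) volume :=
    ρ.hasCompactSupport_normed.convolutionExists_left _
      ρ.continuous_normed hg'.locallyIntegrable x
  ext i
  rw [gradient_apply_euc, hd.fderiv, convolution_eq_swap, convolution_eq_swap,
    ContinuousLinearMap.integral_apply hex.integrable_swap]
  have hproj := (EuclideanSpace.proj (𝕜 := ℝ) i).integral_comp_comm hex'.integrable_swap
  simp only [PiLp.proj_apply] at hproj
  rw [← hproj]
  set φ : Euc n → ℝ := fun y => ρ.normed volume (x - y) with hφ
  have hφs : ContDiff ℝ (⊤ : ℕ∞) φ := ρ.contDiff_normed.comp (contDiff_const.sub contDiff_id)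
  have hsupp : tsupport φ ⊆ closedBall x ρ.rOut := by
    refine closure_minimal (fun y hy => ?_) isClosed_closedBall
    have : x - y ∈ Function.support (ρ.normed volume) := hy
    rw [ρ.support_normed_eq, mem_ball_zero_iff] at this
    rw [mem_closedBall, dist_comm, dist_eq_norm]
    exact this.le
  have hφc : HasCompactSupport φ :=
    (isCompact_closedBall x ρ.rOut).of_isClosed_subset (isClosed_tsupport φ) hsupp
  have hφd : ∀ y v, fderiv ℝ φ y v = - fderiv ℝ (ρ.normed volume) (x - y) v := by
    intro y v
    have h1 : HasFDerivAt (fun y => x - y) (-ContinuousLinearMap.id ℝ (Euc n)) y := by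
      simpa using (hasFDerivAt_id y).const_sub x
    have h2 := (((ρ.contDiff_normed (μ := volume) (n := 1)).differentiable one_ne_zero)
      (x - y)).hasFDerivAt.comp y h1
    have h3 : fderiv ℝ φ y = _ := h2.fderiv
    rw [h3]
    simp
  have hφ0 : ∀ y, y ∉ K → φ y = 0 ∧ fderiv ℝ φ y = 0 := by
    intro y hy
    have hy' : y ∉ tsupport φ := fun h => hy (hx (hsupp h))
    exact ⟨image_eq_zero_of_notMem_tsupport hy', by
      by_contra h
      exact hy' (support_fderiv_subset ℝ (Function.mem_support.2 h))⟩
  have key := hu.2.2 φ hφs hφc (hsupp.trans (hx.trans hKΩ)) i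
  have e1 : ∀ t, (((ContinuousLinearMap.lsmul ℝ ℝ).precompL (Euc n))
      (fderiv ℝ (ρ.normed volume) (x - t)) (K.indicator u t)) (EuclideanSpace.single i 1)
      = - (u t * fderiv ℝ φ t (EuclideanSpace.single i 1)) := by
    intro t
    by_cases ht : t ∈ K
    · simp [ContinuousLinearMap.precompL_apply, ht, hφd, mul_comm]
    · simp [ht, (hφ0 t ht).2]
  have e2 : ∀ t, (((ContinuousLinearMap.lsmul ℝ ℝ) (ρ.normed volume (x - t))
      (K.indicator g t)).ofLp i) = g t i * φ t := by
    intro t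
    by_cases ht : t ∈ K
    · simp [ht, hφ, mul_comm]
    · simp [ht, (hφ0 t ht).1]
  rw [integral_congr_ae (.of_forall e1), integral_congr_ae (.of_forall e2), integral_neg, key,
    neg_neg]

open scoped Convolution in
lemma exists_smooth_approx {n : ℕ} {Ω : Set (Euc n)} (hΩ : IsOpen Ω) {u : Euc n → ℝ}
    {g : Euc n → Euc n} (hu : IsWeakGradOn Ω u g) (hg : LocallyIntegrableOn g Ω)
    {x₀ : Euc n} {R : ℝ} (hR : 0 < R) (hB : closedBall x₀ R ⊆ Ω) :
    ∃ w : ℕ → Euc n → ℝ, (∀ j, ContDiff ℝ (⊤ : ℕ∞) (w j)) ∧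
      (∀ᵐ x ∂volume.restrict (ball x₀ R), Tendsto (fun j => w j x) atTop (𝓝 (u x))) ∧
      Tendsto (fun j => ∫⁻ x in ball x₀ R, ‖w j x - u x‖ₑ) atTop (𝓝 0) ∧
      Tendsto (fun j => ∫⁻ x in ball x₀ R, ‖gradient (w j) x - g x‖ₑ) atTop (𝓝 0) := by
  obtain ⟨δ, hδ, hδΩ⟩ := (isCompact_closedBall x₀ R).exists_cthickening_subset_open hΩ hB
  rw [cthickening_closedBall hδ.le hR.le] at hδΩ
  set K := closedBall x₀ (δ + R) with hKdef
  have hK : IsCompact K := isCompact_closedBall _ _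
  have hui : IntegrableOn u K := (hu.1.mono_set hδΩ).integrableOn_isCompact hK
  have hgi : IntegrableOn g K := (hg.mono_set hδΩ).integrableOn_isCompact hK
  have hu' : Integrable (K.indicator u) := hui.integrable_indicator hK.measurableSet
  have hg' : Integrable (K.indicator g) := hgi.integrable_indicator hK.measurableSet
  have hpos : ∀ j : ℕ, (0 : ℝ) < 1 / ((j : ℝ) + 1) := fun j => Nat.one_div_pos_of_nat
  let ρ : ℕ → ContDiffBump (0 : Euc n) := fun j =>
    ⟨δ / 2 * (1 / ((j : ℝ) + 1)), δ * (1 / ((j : ℝ) + 1)), by have := hpos j; positivity, by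
      have := mul_pos hδ (hpos j); linarith⟩
  have hρ0 : Tendsto (fun j => (ρ j).rOut) atTop (𝓝 0) := by
    have := (tendsto_one_div_add_atTop_nhds_zero_nat (𝕜 := ℝ)).const_mul δ
    rwa [mul_zero] at this
  have hρK : ∀ j, (ρ j).rOut ≤ 2 * (ρ j).rIn := fun j => by
    change δ * (1 / ((j : ℝ) + 1)) ≤ 2 * (δ / 2 * (1 / ((j : ℝ) + 1)))
    linarith
  have hρδ : ∀ j, (ρ j).rOut ≤ δ := fun j => by
    change δ * (1 / ((j : ℝ) + 1)) ≤ δ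
    refine mul_le_of_le_one_right hδ.le ?_
    rw [div_le_one (by positivity)]
    linarith [(Nat.cast_nonneg j : (0 : ℝ) ≤ j)]
  have hsub : ball x₀ R ⊆ K :=
    ball_subset_closedBall.trans (closedBall_subset_closedBall (by linarith))
  refine ⟨fun j => (ρ j).normed volume ⋆[ContinuousLinearMap.lsmul ℝ ℝ, volume] K.indicator u,
    fun j => ?_, ?_, ?_, ?_⟩
  · exact (ρ j).hasCompactSupport_normed.contDiff_convolution_left _ (ρ j).contDiff_normed
      hu'.locallyIntegrable
  · filter_upwards [ae_restrict_of_ae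
      (ContDiffBump.ae_convolution_tendsto_right_of_locallyIntegrable hρ0 (.of_forall hρK)
      hu'.locallyIntegrable), ae_restrict_mem measurableSet_ball] with x hx hxB
    simpa [indicator_of_mem (hsub hxB)] using hx
  · refine tendsto_of_tendsto_of_tendsto_of_le_of_le tendsto_const_nhds
      (tendsto_lintegral_enorm_convolution_sub volume ρ hρ0 hρK hu') (fun _ => bot_le) fun j => ?_
    refine le_trans (le_of_eq ?_) (setLIntegral_le_lintegral (ball x₀ R) _)
    refine setLIntegral_congr_fun measurableSet_ball fun x hx => ?_
    simp only [indicator_of_mem (hsub hx)]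
  · refine tendsto_of_tendsto_of_tendsto_of_le_of_le tendsto_const_nhds
      (tendsto_lintegral_enorm_convolution_sub volume ρ hρ0 hρK hg') (fun _ => bot_le) fun j => ?_
    refine le_trans (le_of_eq ?_) (setLIntegral_le_lintegral (ball x₀ R) _)
    refine setLIntegral_congr_fun measurableSet_ball fun x hx => ?_
    simp only
    rw [gradient_convolution_eq hu (ρ j) hK.measurableSet hδΩ hui hgi, indicator_of_mem (hsub hx)]
    refine closedBall_subset_closedBall' ?_
    have := hρδ j
    rw [mem_ball] at hx
    linarith

end approximation


section weakGradient

lemma integrable_mul_of_tsupport_subset {n : ℕ} {Ω : Set (Euc n)} {γ f : Euc n → ℝ}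
    (hγ : LocallyIntegrableOn γ Ω) (hf : Continuous f) (hfc : HasCompactSupport f)
    (hfΩ : tsupport f ⊆ Ω) : Integrable fun x => γ x * f x := by
  have h1 : IntegrableOn γ (tsupport f) :=
    (hγ.mono_set hfΩ).integrableOn_isCompact hfc
  have h2 : IntegrableOn (fun x => γ x * f x) (tsupport f) :=
    h1.mul_continuousOn hf.continuousOn hfc
  refine (integrableOn_iff_integrable_of_support_subset fun x hx => ?_).1 h2
  exact subset_tsupport f (right_ne_zero_of_mul hx)

lemma exists_contDiff_eq_one_near {n : ℕ} {Ω : Set (Euc n)} (hΩ : IsOpen Ω) {x : Euc n}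
    (hx : x ∈ Ω) : ∃ r > 0, ∃ φ : Euc n → ℝ, ContDiff ℝ (⊤ : ℕ∞) φ ∧ HasCompactSupport φ ∧
      tsupport φ ⊆ Ω ∧ ∀ y ∈ closedBall x r, φ y = 1 := by
  obtain ⟨r, hr, hrΩ⟩ := nhds_basis_closedBall.mem_iff.1 (hΩ.mem_nhds hx)
  let b : ContDiffBump x := ⟨r / 2, r, by positivity, by linarith⟩
  refine ⟨r / 2, by positivity, b, b.contDiff, b.hasCompactSupport, ?_, fun y hy =>
    b.one_of_mem_closedBall hy⟩
  rw [b.tsupport_eq]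
  exact hrΩ

lemma exists_locallyIntegrableOn_partial {n : ℕ} {Ω : Set (Euc n)} (hΩ : IsOpen Ω)
    {u : Euc n → ℝ} {g : Euc n → Euc n} (hu : IsWeakGradOn Ω u g) (i : Fin n) :
    ∃ γ : Euc n → ℝ, LocallyIntegrableOn γ Ω ∧
      ∀ φ : Euc n → ℝ, ContDiff ℝ (⊤ : ℕ∞) φ → HasCompactSupport φ → tsupport φ ⊆ Ω →
        ∫ x, u x * fderiv ℝ φ x (EuclideanSpace.single i 1) = - ∫ x, γ x * φ x := by
  by_cases h : ∃ φ : Euc n → ℝ, ContDiff ℝ (⊤ : ℕ∞) φ ∧ HasCompactSupport φ ∧ tsupport φ ⊆ Ω ∧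
      ∫ x, u x * fderiv ℝ φ x (EuclideanSpace.single i 1) ≠ 0
  swap
  · push Not at h
    exact ⟨0, (locallyIntegrable_zero).locallyIntegrableOn Ω, fun φ h1 h2 h3 => by
      simp [h φ h1 h2 h3]⟩
  obtain ⟨φ, hφ, hφc, hφΩ, hne⟩ := h
  have hint : ∀ ψ : Euc n → ℝ, ContDiff ℝ (⊤ : ℕ∞) ψ → HasCompactSupport ψ → tsupport ψ ⊆ Ω →
      ∫ x, u x * fderiv ℝ ψ x (EuclideanSpace.single i 1) ≠ 0 →
      Integrable fun x => g x i * ψ x := by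
    intro ψ h1 h2 h3 h4
    by_contra hn
    rw [hu.2.2 ψ h1 h2 h3 i, integral_undef hn] at h4
    simp at h4
  have hall : ∀ ψ : Euc n → ℝ, ContDiff ℝ (⊤ : ℕ∞) ψ → HasCompactSupport ψ → tsupport ψ ⊆ Ω →
      Integrable fun x => g x i * ψ x := by
    intro ψ h1 h2 h3
    by_cases h4 : ∫ x, u x * fderiv ℝ ψ x (EuclideanSpace.single i 1) = 0
    swap
    · exact hint ψ h1 h2 h3 h4
    have hd : ∀ χ : Euc n → ℝ, ContDiff ℝ (⊤ : ℕ∞) χ → HasCompactSupport χ → tsupport χ ⊆ Ω →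
        Integrable fun x => u x * fderiv ℝ χ x (EuclideanSpace.single i 1) := by
      intro χ k1 k2 k3
      refine integrable_mul_of_tsupport_subset hu.1
        ((k1.continuous_fderiv (by simp)).clm_apply continuous_const)
        (k2.fderiv_apply ℝ _) ((tsupport_fderiv_apply_subset ℝ _).trans k3)
    have hs : Integrable fun x => g x i * (ψ x + φ x) := by
      refine hint (fun x => ψ x + φ x) (h1.add hφ) (h2.add hφc)
        ((tsupport_add ψ φ).trans (union_subset h3 hφΩ)) ?_
      have : ∀ x, u x * fderiv ℝ (fun x => ψ x + φ x) x (EuclideanSpace.single i 1)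
          = u x * fderiv ℝ ψ x (EuclideanSpace.single i 1)
            + u x * fderiv ℝ φ x (EuclideanSpace.single i 1) := by
        intro x
        rw [fderiv_fun_add (h1.differentiable (by simp) x) (hφ.differentiable (by simp) x)]
        simp [mul_add]
      simp_rw [this]
      rw [integral_add (hd ψ h1 h2 h3) (hd φ hφ hφc hφΩ), h4, zero_add]
      exact hne
    refine (hs.sub (hint φ hφ hφc hφΩ hne)).congr (.of_forall fun x => ?_)
    simp only [Pi.sub_apply]
    ring
  refine ⟨fun x => g x i, fun x hx => ?_, fun ψ h1 h2 h3 => hu.2.2 ψ h1 h2 h3 i⟩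
  obtain ⟨r, hr, ψ, h1, h2, h3, h4⟩ := exists_contDiff_eq_one_near hΩ hx
  refine ⟨closedBall x r, mem_nhdsWithin_of_mem_nhds (closedBall_mem_nhds x hr), ?_⟩
  refine (hall ψ h1 h2 h3).integrableOn.congr_fun (fun y hy => ?_) measurableSet_closedBall
  simp [h4 y hy]

lemma IsWeakGradOn.exists_locallyIntegrableOn {n : ℕ} {Ω : Set (Euc n)} (hΩ : IsOpen Ω)
    {u : Euc n → ℝ} {g : Euc n → Euc n} (hu : IsWeakGradOn Ω u g) :
    ∃ g' : Euc n → Euc n, LocallyIntegrableOn g' Ω ∧ IsWeakGradOn Ω u g' := by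
  choose γ hγ hγw using exists_locallyIntegrableOn_partial hΩ hu
  have hloc : LocallyIntegrableOn (fun x => WithLp.toLp 2 fun i => γ i x : Euc n → Euc n) Ω := by
    rw [locallyIntegrableOn_iff hΩ.isLocallyClosed]
    intro K hK hKc
    refine Integrable.of_eval_piLp fun i => ?_
    exact ((hγ i).mono_set hK).integrableOn_isCompact hKc
  exact ⟨_, hloc, hu.1, hloc.norm, fun φ h1 h2 h3 i => hγw i φ h1 h2 h3⟩

lemma isWeakGradOn_of_tendsto {n : ℕ} {B : Set (Euc n)} {v : Euc n → ℝ} {h : Euc n → Euc n}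
    (hv : IntegrableOn v B) (hh : IntegrableOn h B) {φ : ℕ → Euc n → ℝ}
    (hφ : ∀ k, ContDiff ℝ (⊤ : ℕ∞) (φ k) ∧ HasCompactSupport (φ k))
    (h0 : Tendsto (fun k => ∫⁻ x in B, ‖φ k x - v x‖ₑ) atTop (𝓝 0))
    (h1 : Tendsto (fun k => ∫⁻ x in B, ‖gradient (φ k) x - h x‖ₑ) atTop (𝓝 0)) :
    IsWeakGradOn B v h := by
  refine ⟨hv.locallyIntegrableOn, IntegrableOn.locallyIntegrableOn hh.norm, fun ψ hψ hψc hψB i => ?_⟩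
  have aux : ∀ (f : ℕ → Euc n → ℝ) (f' η : Euc n → ℝ), (∀ k, IntegrableOn (f k) B) →
      IntegrableOn f' B → Continuous η → HasCompactSupport η → tsupport η ⊆ B →
      Tendsto (fun k => ∫⁻ x in B, ‖f k x - f' x‖ₑ) atTop (𝓝 0) →
      Tendsto (fun k => ∫ x, f k x * η x) atTop (𝓝 (∫ x, f' x * η x)) := by
    intro f f' η hf hf' hη hηc hηB ht
    have hsub : ∀ q : Euc n → ℝ, ∫ x, q x * η x = ∫ x in B, q x * η x := by
      intro q
      refine (setIntegral_eq_integral_of_forall_compl_eq_zero fun x hx => ?_).symm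
      rw [image_eq_zero_of_notMem_tsupport fun hx' => hx (hηB hx'), mul_zero]
    obtain ⟨C, hC⟩ := hη.bounded_above_of_compact_support hηc
    have hmul : ∀ q : Euc n → ℝ, IntegrableOn q B → IntegrableOn (fun x => q x * η x) B :=
      fun q hq => hq.mul_bdd hη.aestronglyMeasurable (.of_forall hC)
    simp_rw [hsub]
    refine tendsto_integral_of_L1 _ (hmul f' hf').aestronglyMeasurable (.of_forall fun k => hmul _ (hf k)) ?_
    have hCm := ENNReal.Tendsto.const_mul (a := ENNReal.ofReal C) ht (Or.inr ofReal_ne_top)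
    rw [mul_zero] at hCm
    refine tendsto_of_tendsto_of_tendsto_of_le_of_le tendsto_const_nhds hCm (fun _ => bot_le)
      fun k => ?_
    simp only
    rw [← lintegral_const_mul' _ _ ofReal_ne_top]
    refine lintegral_mono fun x => ?_
    rw [← sub_mul, enorm_mul, mul_comm]
    gcongr
    rw [← ofReal_norm]
    exact ENNReal.ofReal_le_ofReal (hC x)
  have hφi : ∀ k, Integrable (φ k) := fun k =>
    (hφ k).1.continuous.integrable_of_hasCompactSupport (hφ k).2
  have hdc : ∀ k, Continuous fun x => gradient (φ k) x i := fun k => by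
    simp_rw [gradient_apply_euc]
    exact ((hφ k).1.continuous_fderiv (by simp)).clm_apply continuous_const
  have hdi : ∀ k, Integrable fun x => gradient (φ k) x i := fun k => by
    refine (hdc k).integrable_of_hasCompactSupport ?_
    simp_rw [gradient_apply_euc]
    exact (hφ k).2.fderiv_apply ℝ _
  have hhi : IntegrableOn (fun x => h x i) B := hh.eval_piLp i
  have t0 := aux φ v (fun x => fderiv ℝ ψ x (EuclideanSpace.single i 1))
    (fun k => (hφi k).integrableOn) hv
    ((hψ.continuous_fderiv (by simp)).clm_apply continuous_const)
    (hψc.fderiv_apply ℝ _) ((tsupport_fderiv_apply_subset ℝ _).trans hψB) h0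
  have t1 := aux (fun k x => gradient (φ k) x i) (fun x => h x i) ψ
    (fun k => (hdi k).integrableOn) hhi hψ.continuous hψc hψB (by
      refine tendsto_of_tendsto_of_tendsto_of_le_of_le tendsto_const_nhds h1 (fun _ => bot_le)
        fun k => lintegral_mono fun x => ?_
      have := PiLp.norm_apply_le (gradient (φ k) x - h x) i
      exact enorm_le_iff_norm_le.2 this)
  refine tendsto_nhds_unique t0 (t1.neg.congr fun k => ?_)
  have := integral_mul_fderiv_eq_neg_fderiv_mul_of_integrable (μ := volume) (f := φ k) (g := ψ)
    (v := EuclideanSpace.single i (1 : ℝ)) ?_ ?_ ?_ (fun x _ => (hφ k).1.differentiable (by simp) x)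
    (fun x _ => hψ.differentiable (by simp) x)
  · rw [this]
    simp_rw [gradient_apply_euc]
  · simp_rw [← gradient_apply_euc]
    exact ((hdc k).mul hψ.continuous).integrable_of_hasCompactSupport hψc.mul_left
  · exact ((hφ k).1.continuous.mul ((hψ.continuous_fderiv (by simp)).clm_apply
      continuous_const)).integrable_of_hasCompactSupport (hψc.fderiv_apply ℝ _).mul_left
  · exact ((hφ k).1.continuous.mul hψ.continuous).integrable_of_hasCompactSupport hψc.mul_left

end weakGradient


section truncation

lemma exists_smooth_positivePart : ∃ (α : ℝ → ℝ) (C : ℝ), ContDiff ℝ (⊤ : ℕ∞) α ∧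
    (∀ s ≤ 1, α s = 0) ∧ (∀ s, 2 ≤ s → α s = s) ∧ (∀ s, |α s| ≤ |s|) ∧
    ∀ s, |deriv α s| ≤ C := by
  have hcd : ContDiff ℝ (⊤ : ℕ∞) fun s : ℝ => s * Real.smoothTransition (s - 1) :=
    contDiff_id.mul (Real.smoothTransition.contDiff.comp (contDiff_id.sub contDiff_const))
  have h0 : ∀ s : ℝ, s ≤ 1 → s * Real.smoothTransition (s - 1) = 0 := fun s hs => by
    rw [Real.smoothTransition.zero_of_nonpos (by linarith), mul_zero]
  have h1 : ∀ s : ℝ, 2 ≤ s → s * Real.smoothTransition (s - 1) = s := fun s hs => by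
    rw [Real.smoothTransition.one_of_one_le (by linarith), mul_one]
  have hdc : Continuous (deriv fun s : ℝ => s * Real.smoothTransition (s - 1)) :=
    hcd.continuous_deriv (by simp)
  obtain ⟨C, hC⟩ := (isCompact_Icc (a := (0 : ℝ)) (b := 3)).exists_bound_of_continuousOn
    hdc.continuousOn
  refine ⟨_, max C 1, hcd, h0, h1, fun s => ?_, fun s => ?_⟩
  · rw [abs_mul, abs_of_nonneg (Real.smoothTransition.nonneg _)]
    exact mul_le_of_le_one_right (abs_nonneg _) (Real.smoothTransition.le_one _)
  · rcases lt_or_ge s 1 with hs | hs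
    · have : (fun s : ℝ => s * Real.smoothTransition (s - 1)) =ᶠ[𝓝 s] fun _ => 0 := by
        filter_upwards [Iio_mem_nhds hs] with t ht using h0 t (le_of_lt ht)
      rw [this.deriv_eq]
      simp
    rcases lt_or_ge 2 s with hs' | hs'
    · have : (fun s : ℝ => s * Real.smoothTransition (s - 1)) =ᶠ[𝓝 s] id := by
        filter_upwards [Ioi_mem_nhds hs'] with t ht using h1 t (le_of_lt ht)
      rw [this.deriv_eq]
      simp
    · exact (hC s ⟨by linarith, by linarith⟩).trans (le_max_left _ _)

lemma exists_smooth_truncation {m M : ℝ} (hmM : m ≤ M) : ∃ (T : ℕ → ℝ → ℝ) (C : ℝ),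
    (∀ k, ContDiff ℝ (⊤ : ℕ∞) (T k)) ∧
    (∀ k, ∃ δ > 0, ∀ t ∈ Ioo (m - δ) (M + δ), T k t = 0) ∧
    (∀ k t, |deriv (T k) t| ≤ C) ∧
    (∀ k t, |T k t| ≤ |t - M| + |m - t|) ∧
    (∀ t, Tendsto (fun k => T k t) atTop (𝓝 (max (t - M) 0 - max (m - t) 0))) ∧
    ∀ t, Tendsto (fun k => deriv (T k) t) atTop (𝓝 ((Icc m M)ᶜ.indicator 1 t)) := by
  obtain ⟨α, C, hα, h0, h1, hle, hC⟩ := exists_smooth_positivePart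
  have hκ : ∀ k : ℕ, (0 : ℝ) < (k : ℝ) + 1 := fun k => by positivity
  have hκt : Tendsto (fun k : ℕ => (k : ℝ) + 1) atTop atTop :=
    tendsto_atTop_add_const_right _ _ tendsto_natCast_atTop_atTop
  have hbig : ∀ s : ℝ, 0 < s → ∀ᶠ k : ℕ in atTop, 2 < ((k : ℝ) + 1) * s := fun s hs =>
    (hκt.atTop_mul_const hs).eventually_gt_atTop 2
  have hneg : ∀ s : ℝ, s ≤ 0 → ∀ k : ℕ, ((k : ℝ) + 1) * s ≤ 0 := fun s hs k =>
    mul_nonpos_of_nonneg_of_nonpos (hκ k).le hs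
  have hval : ∀ s : ℝ, ∀ᶠ k : ℕ in atTop, α (((k : ℝ) + 1) * s) / ((k : ℝ) + 1) = max s 0 := by
    intro s
    rcases le_or_gt s 0 with hs | hs
    · refine .of_forall fun k => ?_
      rw [h0 _ ((hneg s hs k).trans zero_le_one), max_eq_right hs, zero_div]
    · filter_upwards [hbig s hs] with k hk
      rw [h1 _ hk.le, max_eq_left hs.le, mul_div_cancel_left₀ _ (hκ k).ne']
  have hd0 : ∀ s < 1, deriv α s = 0 := fun s hs => by
    have : α =ᶠ[𝓝 s] fun _ => 0 := by
      filter_upwards [Iio_mem_nhds hs] with t ht using h0 t (le_of_lt ht)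
    rw [this.deriv_eq]
    simp
  have hd1 : ∀ s > 2, deriv α s = 1 := fun s hs => by
    have : α =ᶠ[𝓝 s] id := by
      filter_upwards [Ioi_mem_nhds hs] with t ht using h1 t (le_of_lt ht)
    rw [this.deriv_eq]
    simp
  have hder : ∀ (k : ℕ) (t : ℝ), deriv (fun t : ℝ => (α (((k : ℝ) + 1) * (t - M))
      - α (((k : ℝ) + 1) * (m - t))) / ((k : ℝ) + 1)) t
      = deriv α (((k : ℝ) + 1) * (t - M)) + deriv α (((k : ℝ) + 1) * (m - t)) := by
    intro k t
    have e1 : HasDerivAt (fun t : ℝ => ((k : ℝ) + 1) * (t - M)) ((k : ℝ) + 1) t := by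
      simpa using ((hasDerivAt_id t).sub_const M).const_mul ((k : ℝ) + 1)
    have e2 : HasDerivAt (fun t : ℝ => ((k : ℝ) + 1) * (m - t)) (-((k : ℝ) + 1)) t := by
      simpa using ((hasDerivAt_id t).const_sub m).const_mul ((k : ℝ) + 1)
    have hdα : ∀ s, HasDerivAt α (deriv α s) s := fun s =>
      (hα.differentiable (by simp) s).hasDerivAt
    have := (((hdα _).comp t e1).sub ((hdα _).comp t e2)).div_const ((k : ℝ) + 1)
    refine (this.deriv).trans ?_
    have := (hκ k).ne'
    field_simp
    ring
  refine ⟨fun k t => (α (((k : ℝ) + 1) * (t - M)) - α (((k : ℝ) + 1) * (m - t))) / ((k : ℝ) + 1),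
    C + C, fun k => ?_, fun k => ?_, fun k t => ?_, fun k t => ?_, fun t => ?_, fun t => ?_⟩
  · refine ContDiff.div_const (ContDiff.sub (hα.comp ?_) (hα.comp ?_)) _
    · exact contDiff_const.mul (contDiff_id.sub contDiff_const)
    · exact contDiff_const.mul (contDiff_const.sub contDiff_id)
  · refine ⟨1 / ((k : ℝ) + 1), one_div_pos.2 (hκ k), fun t ht => ?_⟩
    have a1 : ((k : ℝ) + 1) * (t - M) ≤ 1 := by
      rw [mul_comm, ← le_div_iff₀ (hκ k)]; linarith [ht.2]
    have a2 : ((k : ℝ) + 1) * (m - t) ≤ 1 := by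
      rw [mul_comm, ← le_div_iff₀ (hκ k)]; linarith [ht.1]
    simp only [h0 _ a1, h0 _ a2, sub_zero, zero_div]
  · rw [hder]
    exact (abs_add_le _ _).trans (add_le_add (hC _) (hC _))
  · rw [abs_div, abs_of_pos (hκ k), div_le_iff₀ (hκ k)]
    refine (abs_sub _ _).trans ((add_le_add (hle _) (hle _)).trans (le_of_eq ?_))
    rw [abs_mul, abs_mul, abs_of_pos (hκ k)]
    ring
  · refine tendsto_const_nhds.congr' ?_
    filter_upwards [hval (t - M), hval (m - t)] with k e1 e2
    rw [sub_div, e1, e2]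
  · refine tendsto_const_nhds.congr' ?_
    simp_rw [hder]
    rcases lt_or_ge M t with h | h
    · filter_upwards [hbig (t - M) (by linarith)] with k hk
      rw [hd1 _ hk, hd0 _ ((hneg (m - t) (by linarith) k).trans_lt one_pos),
        indicator_of_mem (by simp [h])]
      simp
    rcases lt_or_ge t m with h' | h'
    · filter_upwards [hbig (m - t) (by linarith)] with k hk
      rw [hd1 _ hk, hd0 _ ((hneg (t - M) (by linarith) k).trans_lt one_pos),
        indicator_of_mem (by simp [h'])]
      simp
    · refine .of_forall fun k => ?_
      beta_reduce
      rw [hd0 _ ((hneg (t - M) (by linarith) k).trans_lt one_pos),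
        hd0 _ ((hneg (m - t) (by linarith) k).trans_lt one_pos),
        indicator_of_notMem (by simp [h, h'])]
      simp

lemma contDiff_indicator_ball_comp {n : ℕ} {x₀ : Euc n} {r : ℝ} {w : Euc n → ℝ}
    (hw : ContDiff ℝ (⊤ : ℕ∞) w) {T : ℝ → ℝ} (hT : ContDiff ℝ (⊤ : ℕ∞) T) {I : Set ℝ}
    (hI : IsOpen I) (hTI : ∀ t ∈ I, T t = 0) (hs : ∀ x ∈ sphere x₀ r, w x ∈ I) :
    ContDiff ℝ (⊤ : ℕ∞) ((ball x₀ r).indicator fun x => T (w x)) ∧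
      HasCompactSupport ((ball x₀ r).indicator fun x => T (w x)) ∧
      tsupport ((ball x₀ r).indicator fun x => T (w x)) ⊆ ball x₀ r := by
  set φ := (ball x₀ r).indicator fun x => T (w x) with hφ
  set K := closedBall x₀ r \ w ⁻¹' I with hK
  have hKc : IsCompact K :=
    (isCompact_closedBall x₀ r).diff (hI.preimage hw.continuous)
  have hKB : K ⊆ ball x₀ r := by
    rintro x ⟨hx, hxI⟩
    rcases (mem_closedBall.1 hx).lt_or_eq with h | h
    · exact h
    · exact absurd (hs x h) hxI
  have hzero : ∀ x, x ∉ K → φ x = 0 := by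
    intro x hx
    by_cases hxB : x ∈ ball x₀ r
    · have : w x ∈ I := by
        by_contra h
        exact hx ⟨ball_subset_closedBall hxB, h⟩
      rw [hφ, indicator_of_mem hxB, hTI _ this]
    · exact indicator_of_notMem hxB _
  have hsupp : tsupport φ ⊆ K :=
    closure_minimal (fun x hx => by_contra fun h => hx (hzero x h)) hKc.isClosed
  refine ⟨contDiff_iff_contDiffAt.2 fun x => ?_,
    hKc.of_isClosed_subset (isClosed_tsupport φ) hsupp, hsupp.trans hKB⟩
  by_cases hxB : x ∈ ball x₀ r
  · refine (hT.comp hw).contDiffAt.congr_of_eventuallyEq ?_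
    filter_upwards [isOpen_ball.mem_nhds hxB] with y hy
    rw [hφ, indicator_of_mem hy]
    rfl
  · refine (contDiffAt_const (c := (0 : ℝ))).congr_of_eventuallyEq ?_
    filter_upwards [hKc.isClosed.isOpen_compl.mem_nhds fun h => hxB (hKB h)] with y hy
      using hzero y hy

end truncation


section zeroBoundary

lemma lintegral_enorm_sub_le {α E : Type*} [MeasurableSpace α] {μ : Measure α}
    [NormedAddCommGroup E] {f g h : α → E} (hf : AEStronglyMeasurable f μ)
    (hg : AEStronglyMeasurable g μ) :
    ∫⁻ x, ‖f x - h x‖ₑ ∂μ ≤ (∫⁻ x, ‖f x - g x‖ₑ ∂μ) + ∫⁻ x, ‖g x - h x‖ₑ ∂μ := by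
  have hm : AEMeasurable (fun x => ‖f x - g x‖ₑ) μ := (hf.sub hg).enorm
  rw [← lintegral_add_left' hm]
  refine lintegral_mono fun x => ?_
  have : f x - h x = (f x - g x) + (g x - h x) := by abel
  rw [this]
  exact enorm_add_le _ _

lemma tendsto_lintegral_enorm_smul_sub {α E : Type*} [MeasurableSpace α] {μ : Measure α}
    [NormedAddCommGroup E] [NormedSpace ℝ E] {c : ℕ → α → ℝ} {c' : α → ℝ} {g : α → E} {C : ℝ}
    (hg : Integrable g μ) (hc : ∀ j, AEStronglyMeasurable (c j) μ)
    (hc' : AEStronglyMeasurable c' μ) (hb : ∀ j x, |c j x| ≤ C) (hb' : ∀ x, |c' x| ≤ C)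
    (ht : ∀ᵐ x ∂μ, Tendsto (fun j => c j x) atTop (𝓝 (c' x))) :
    Tendsto (fun j => ∫⁻ x, ‖c j x • g x - c' x • g x‖ₑ ∂μ) atTop (𝓝 0) := by
  have hfin : ∫⁻ x, ENNReal.ofReal (2 * C) * ‖g x‖ₑ ∂μ ≠ ∞ := by
    rw [lintegral_const_mul' _ _ ofReal_ne_top]
    exact ENNReal.mul_ne_top ofReal_ne_top hg.2.ne
  have := tendsto_lintegral_of_dominated_convergence' (μ := μ)
    (F := fun j x => ‖c j x • g x - c' x • g x‖ₑ) (f := fun _ => 0)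
    (fun x => ENNReal.ofReal (2 * C) * ‖g x‖ₑ)
    (fun j => (((hc j).smul hg.1).sub (hc'.smul hg.1)).enorm) (fun j => .of_forall fun x => ?_)
    hfin ?_
  · simpa using this
  · beta_reduce
    rw [← sub_smul, enorm_smul, ← ofReal_norm]
    gcongr
    refine (norm_sub_le _ _).trans ?_
    rw [Real.norm_eq_abs, Real.norm_eq_abs]
    linarith [hb j x, hb' x]
  · filter_upwards [ht] with x hx
    have h1 : Tendsto (fun j => ‖c j x • g x - c' x • g x‖ₑ) atTop
        (𝓝 ‖c' x • g x - c' x • g x‖ₑ) :=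
      (continuous_enorm.tendsto _).comp (((hx.smul_const _)).sub_const _)
    simpa using h1

lemma gradient_comp_real {n : ℕ} {T : ℝ → ℝ} {w : Euc n → ℝ} {x : Euc n}
    (hT : DifferentiableAt ℝ T (w x)) (hw : DifferentiableAt ℝ w x) :
    gradient (fun y => T (w y)) x = deriv T (w x) • gradient w x := by
  have h := hT.hasDerivAt.comp_hasFDerivAt x hw.hasFDerivAt
  ext i
  rw [gradient_apply_euc]
  have : fderiv ℝ (fun y => T (w y)) x = _ := h.fderiv
  rw [this]
  simp [gradient_apply_euc]

lemma continuous_gradient {n : ℕ} {w : Euc n → ℝ} (hw : ContDiff ℝ (⊤ : ℕ∞) w) :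
    Continuous (gradient w) :=
  (InnerProductSpace.toDual ℝ (Euc n)).symm.continuous.comp (hw.continuous_fderiv (by simp))

lemma tendsto_lintegral_comp_sub {α : Type*} [MeasurableSpace α] {μ : Measure α} {w : ℕ → α → ℝ}
    {u : α → ℝ} {T : ℝ → ℝ} {C : ℝ} (hT : Differentiable ℝ T) (hC : ∀ t, |deriv T t| ≤ C)
    (h : Tendsto (fun j => ∫⁻ x, ‖w j x - u x‖ₑ ∂μ) atTop (𝓝 0)) :
    Tendsto (fun j => ∫⁻ x, ‖T (w j x) - T (u x)‖ₑ ∂μ) atTop (𝓝 0) := by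
  have hCm := ENNReal.Tendsto.const_mul (a := ENNReal.ofReal C) h (Or.inr ofReal_ne_top)
  rw [mul_zero] at hCm
  refine tendsto_of_tendsto_of_tendsto_of_le_of_le tendsto_const_nhds hCm (fun _ => bot_le)
    fun j => ?_
  simp only
  rw [← lintegral_const_mul' _ _ ofReal_ne_top]
  refine lintegral_mono fun x => ?_
  have hl : ‖T (w j x) - T (u x)‖ ≤ C * ‖w j x - u x‖ :=
    convex_univ.norm_image_sub_le_of_norm_deriv_le (fun t _ => hT t)
      (fun t _ => hC t) (mem_univ _) (mem_univ _)
  rw [← ofReal_norm, ← ofReal_norm, ← ENNReal.ofReal_mul ((abs_nonneg _).trans (hC 0))]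
  exact ENNReal.ofReal_le_ofReal hl

lemma tendsto_lintegral_gradient_comp_sub {n : ℕ} {B : Set (Euc n)} {u : Euc n → ℝ}
    {g : Euc n → Euc n} {w : ℕ → Euc n → ℝ} (hui : IntegrableOn u B) (hgi : IntegrableOn g B)
    (hw : ∀ j, ContDiff ℝ (⊤ : ℕ∞) (w j))
    (hae : ∀ᵐ x ∂volume.restrict B, Tendsto (fun j => w j x) atTop (𝓝 (u x)))
    (h1 : Tendsto (fun j => ∫⁻ x in B, ‖gradient (w j) x - g x‖ₑ) atTop (𝓝 0))
    {T : ℝ → ℝ} {C : ℝ} (hT : ContDiff ℝ (⊤ : ℕ∞) T) (hC : ∀ t, |deriv T t| ≤ C) :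
    Tendsto (fun j => ∫⁻ x in B, ‖deriv T (w j x) • gradient (w j) x - deriv T (u x) • g x‖ₑ)
      atTop (𝓝 0) := by
  have hdT : Continuous (deriv T) := hT.continuous_deriv (by simp)
  have hm : ∀ j, AEStronglyMeasurable (fun x => deriv T (w j x)) (volume.restrict B) :=
    fun j => (hdT.comp (hw j).continuous).aestronglyMeasurable
  have ha : Tendsto (fun j => ∫⁻ x in B,
      ‖deriv T (w j x) • gradient (w j) x - deriv T (w j x) • g x‖ₑ) atTop (𝓝 0) := by
    have hCm := ENNReal.Tendsto.const_mul (a := ENNReal.ofReal C) h1 (Or.inr ofReal_ne_top)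
    rw [mul_zero] at hCm
    refine tendsto_of_tendsto_of_tendsto_of_le_of_le tendsto_const_nhds hCm (fun _ => bot_le)
      fun j => ?_
    simp only
    rw [← lintegral_const_mul' _ _ ofReal_ne_top]
    refine lintegral_mono fun x => ?_
    rw [← smul_sub, enorm_smul, ← ofReal_norm (deriv T (w j x))]
    gcongr
    exact hC _
  have hb := tendsto_lintegral_enorm_smul_sub hgi hm
    (hdT.comp_aestronglyMeasurable hui.1) (fun j x => hC _) (fun x => hC _)
    (by filter_upwards [hae] with x hx using (hdT.tendsto _).comp hx)
  have := ha.add hb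
  rw [add_zero] at this
  refine tendsto_of_tendsto_of_tendsto_of_le_of_le tendsto_const_nhds this (fun _ => bot_le)
    fun j => ?_
  exact lintegral_enorm_sub_le ((hm j).smul (continuous_gradient (hw j)).aestronglyMeasurable)
    ((hm j).smul hgi.1)

lemma memW110_truncation {n : ℕ} {x₀ : Euc n} {r : ℝ} {u : Euc n → ℝ}
    {g : Euc n → Euc n} {w : ℕ → Euc n → ℝ} (hui : IntegrableOn u (ball x₀ r))
    (hgi : IntegrableOn g (ball x₀ r)) (hw : ∀ j, ContDiff ℝ (⊤ : ℕ∞) (w j))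
    (hae : ∀ᵐ x ∂volume.restrict (ball x₀ r), Tendsto (fun j => w j x) atTop (𝓝 (u x)))
    (h0 : Tendsto (fun j => ∫⁻ x in ball x₀ r, ‖w j x - u x‖ₑ) atTop (𝓝 0))
    (h1 : Tendsto (fun j => ∫⁻ x in ball x₀ r, ‖gradient (w j) x - g x‖ₑ) atTop (𝓝 0))
    {m M : ℝ} (hmM : m ≤ M)
    (hb : ∀ δ > 0, ∃ᶠ j in atTop, ∀ x ∈ sphere x₀ r, w j x ∈ Ioo (m - δ) (M + δ)) :
    MemW110 (ball x₀ r) (fun x => max (u x - M) 0 - max (m - u x) 0) := by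
  obtain ⟨T, C, hT, hT0, hTC, hTle, hTlim, hTdlim⟩ := exists_smooth_truncation hmM
  set B := ball x₀ r with hB
  set W : ℝ → ℝ := fun t => max (t - M) 0 - max (m - t) 0 with hW
  set χ : ℝ → ℝ := (Icc m M)ᶜ.indicator 1 with hχ
  have hconst : ∀ c : ℝ, IntegrableOn (fun _ => c) B := fun c =>
    integrableOn_const measure_ball_lt_top.ne
  have hWc : Continuous W := by fun_prop
  have hWi : IntegrableOn (fun x => W (u x)) B :=
    ((hui.sub (hconst M)).pos_part).sub (((hconst m).sub hui).pos_part)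
  have hχm : Measurable χ := measurable_one.indicator measurableSet_Icc.compl
  have hχ1 : ∀ t, |χ t| ≤ 1 := fun t => by
    by_cases ht : t ∈ (Icc m M)ᶜ
    · simp [hχ, indicator_of_mem ht]
    · simp [hχ, indicator_of_notMem ht]
  have hχu : AEStronglyMeasurable (fun x => χ (u x)) (volume.restrict B) :=
    (hχm.comp_aemeasurable hui.1.aemeasurable).aestronglyMeasurable
  have hhi : IntegrableOn (fun x => χ (u x) • g x) B :=
    hgi.bdd_smul 1 hχu (.of_forall fun x => hχ1 _)
  have hTu : ∀ k, AEStronglyMeasurable (fun x => T k (u x)) (volume.restrict B) := fun k =>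
    (hT k).continuous.comp_aestronglyMeasurable hui.1
  have hTdu : ∀ k, AEStronglyMeasurable (fun x => deriv (T k) (u x)) (volume.restrict B) :=
    fun k => ((hT k).continuous_deriv (by simp)).comp_aestronglyMeasurable hui.1
  have hA0 : Tendsto (fun k => ∫⁻ x in B, ‖T k (u x) - W (u x)‖ₑ) atTop (𝓝 0) := by
    have hdi : IntegrableOn (fun x => 2 * (‖u x - M‖ + ‖m - u x‖)) B :=
      (((hui.sub (hconst M)).norm).add ((hconst m).sub hui).norm).const_mul 2
    have := tendsto_lintegral_of_dominated_convergence' (μ := volume.restrict B)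
      (F := fun k x => ‖T k (u x) - W (u x)‖ₑ) (f := fun _ => 0)
      (fun x => ‖2 * (‖u x - M‖ + ‖m - u x‖)‖ₑ)
      (fun k => ((hTu k).sub hWi.1).enorm) (fun k => .of_forall fun x => ?_) hdi.2.ne ?_
    · simpa using this
    · refine enorm_le_iff_norm_le.2 ?_
      rw [Real.norm_of_nonneg (r := 2 * _) (by positivity)]
      have e1 := hTle k (u x)
      have e2 : |W (u x)| ≤ |u x - M| + |m - u x| := by
        refine (abs_sub _ _).trans (add_le_add ?_ ?_)
        · rw [abs_of_nonneg (le_max_right _ _)]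
          exact max_le (le_abs_self _) (abs_nonneg _)
        · rw [abs_of_nonneg (le_max_right _ _)]
          exact max_le (le_abs_self _) (abs_nonneg _)
      refine (norm_sub_le _ _).trans ?_
      simp only [Real.norm_eq_abs]
      linarith
    · refine .of_forall fun x => ?_
      have h1 : Tendsto (fun k => ‖T k (u x) - W (u x)‖ₑ) atTop (𝓝 ‖W (u x) - W (u x)‖ₑ) :=
        (continuous_enorm.tendsto _).comp ((hTlim (u x)).sub_const _)
      simpa using h1
  have hA1 : Tendsto (fun k => ∫⁻ x in B, ‖deriv (T k) (u x) • g x - χ (u x) • g x‖ₑ) atTop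
      (𝓝 0) :=
    tendsto_lintegral_enorm_smul_sub (C := max C 1) hgi hTdu hχu
      (fun k x => (hTC k _).trans (le_max_left _ _)) (fun x => (hχ1 _).trans (le_max_right _ _))
      (.of_forall fun x => hTdlim (u x))
  have hstep : ∀ ε : ℝ≥0∞, 0 < ε → ∃ φ : Euc n → ℝ, (ContDiff ℝ (⊤ : ℕ∞) φ ∧ HasCompactSupport φ ∧
      tsupport φ ⊆ B) ∧ ∫⁻ x in B, ‖φ x - W (u x)‖ₑ ≤ ε ∧
      ∫⁻ x in B, ‖gradient φ x - χ (u x) • g x‖ₑ ≤ ε := by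
    intro ε hε
    have hε2 : 0 < ε / 2 := ENNReal.half_pos hε.ne'
    obtain ⟨k, hk0, hk1⟩ := ((hA0.eventually_lt_const hε2).and (hA1.eventually_lt_const hε2)).exists
    obtain ⟨δ, hδ, hTδ⟩ := hT0 k
    have hB0 := tendsto_lintegral_comp_sub ((hT k).differentiable (by simp)) (hTC k) h0
    have hB1 := tendsto_lintegral_gradient_comp_sub hui hgi hw hae h1 (hT k) (hTC k)
    obtain ⟨j, hjs, hj0, hj1⟩ := ((hb δ hδ).and_eventually
      ((hB0.eventually_lt_const hε2).and (hB1.eventually_lt_const hε2))).exists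
    refine ⟨B.indicator fun x => T k (w j x),
      contDiff_indicator_ball_comp (hw j) (hT k) isOpen_Ioo hTδ hjs, ?_, ?_⟩
    · calc ∫⁻ x in B, ‖B.indicator (fun x => T k (w j x)) x - W (u x)‖ₑ
          = ∫⁻ x in B, ‖T k (w j x) - W (u x)‖ₑ :=
            setLIntegral_congr_fun measurableSet_ball fun x hx => by
              simp only [indicator_of_mem hx]
        _ ≤ _ := lintegral_enorm_sub_le
              ((hT k).continuous.comp (hw j).continuous).aestronglyMeasurable (hTu k)
        _ ≤ ε / 2 + ε / 2 := add_le_add hj0.le hk0.le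
        _ = ε := ENNReal.add_halves ε
    · calc ∫⁻ x in B, ‖gradient (B.indicator fun x => T k (w j x)) x - χ (u x) • g x‖ₑ
          = ∫⁻ x in B, ‖deriv (T k) (w j x) • gradient (w j) x - χ (u x) • g x‖ₑ :=
            setLIntegral_congr_fun measurableSet_ball fun x hx => by
              have he : (B.indicator fun x => T k (w j x)) =ᶠ[𝓝 x] fun x => T k (w j x) := by
                filter_upwards [isOpen_ball.mem_nhds hx] with y hy using indicator_of_mem hy _
              rw [he.gradient.eq_of_nhds, gradient_comp_real ((hT k).differentiable (by simp) _)
                ((hw j).differentiable (by simp) _)]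
        _ ≤ _ := lintegral_enorm_sub_le (((((hT k).continuous_deriv (by simp)).comp
              (hw j).continuous).smul (continuous_gradient (hw j))).aestronglyMeasurable)
              ((hTdu k).smul hgi.1)
        _ ≤ ε / 2 + ε / 2 := add_le_add hj1.le hk1.le
        _ = ε := ENNReal.add_halves ε
  have hseq : ∀ k : ℕ, (0 : ℝ≥0∞) < ((k : ℝ≥0∞) + 1)⁻¹ := fun k =>
    ENNReal.inv_pos.2 (by finiteness)
  choose φ hφ hφ0 hφ1 using fun k : ℕ => hstep _ (hseq k)
  have hε0 : Tendsto (fun k : ℕ => ((k : ℝ≥0∞) + 1)⁻¹) atTop (𝓝 0) := by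
    have := (tendsto_add_atTop_iff_nat 1).2 ENNReal.tendsto_inv_nat_nhds_zero
    simpa using this
  have t0 := tendsto_of_tendsto_of_tendsto_of_le_of_le tendsto_const_nhds hε0
    (fun _ => bot_le) hφ0
  have t1 := tendsto_of_tendsto_of_tendsto_of_le_of_le tendsto_const_nhds hε0
    (fun _ => bot_le) hφ1
  refine ⟨fun x => χ (u x) • g x, isWeakGradOn_of_tendsto hWi hhi
    (fun k => ⟨(hφ k).1, (hφ k).2.1⟩) t0 t1, φ, hφ, ?_⟩
  have t2 : Tendsto (fun k => (∫⁻ x in B, ‖φ k x - W (u x)‖ₑ)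
      + ∫⁻ x in B, ‖gradient (φ k) x - χ (u x) • g x‖ₑ) atTop (𝓝 0) := by
    simpa using t0.add t1
  have t3 := (ENNReal.tendsto_toReal zero_ne_top).comp t2
  rw [toReal_zero] at t3
  refine squeeze_zero' (.of_forall fun k => integral_nonneg fun x => by positivity) ?_ t3
  filter_upwards [t2.eventually_lt_const zero_lt_top] with k hk
  have hle := norm_integral_le_lintegral_norm (μ := volume.restrict B)
    fun x => |φ k x - W (u x)| + ‖gradient (φ k) x - χ (u x) • g x‖
  refine (le_abs_self _).trans (hle.trans (ENNReal.toReal_mono hk.ne (le_of_eq ?_)))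
  have hm : AEMeasurable (fun x => ‖φ k x - W (u x)‖ₑ) (volume.restrict B) :=
    ((hφ k).1.continuous.aestronglyMeasurable.sub hWi.1).enorm
  beta_reduce
  rw [← lintegral_add_left' hm]
  refine lintegral_congr fun x => ?_
  rw [Real.norm_of_nonneg (by positivity), ENNReal.ofReal_add (abs_nonneg _) (norm_nonneg _),
    ofReal_norm, ← Real.norm_eq_abs, ofReal_norm]

end zeroBoundary

section circles

/-- The point of the circle of radius `r` about `x₀` at angle `θ`. -/
def circlePoint (x₀ : Euc 2) (r θ : ℝ) : Euc 2 :=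
  x₀ + Complex.orthonormalBasisOneI.repr (r * (Real.cos θ + Real.sin θ * Complex.I))

lemma continuous_circlePoint (x₀ : Euc 2) :
    Continuous fun p : ℝ × ℝ => circlePoint x₀ p.1 p.2 := by
  unfold circlePoint
  fun_prop

lemma norm_cos_add_sin_mul_I (θ : ℝ) : ‖(Real.cos θ : ℂ) + Real.sin θ * Complex.I‖ = 1 := by
  rw [Complex.ofReal_cos, Complex.ofReal_sin, ← Complex.exp_mul_I, Complex.norm_exp_ofReal_mul_I]

lemma dist_circlePoint (x₀ : Euc 2) (r θ : ℝ) : dist (circlePoint x₀ r θ) x₀ = |r| := by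
  rw [dist_eq_norm, circlePoint, add_sub_cancel_left, LinearIsometryEquiv.norm_map, norm_mul,
    norm_cos_add_sin_mul_I, mul_one, Complex.norm_real, Real.norm_eq_abs]

lemma exists_circlePoint_eq {x₀ y : Euc 2} {r : ℝ} (hy : y ∈ sphere x₀ r) :
    ∃ θ ∈ Icc (-Real.pi) Real.pi, circlePoint x₀ r θ = y := by
  set z := Complex.orthonormalBasisOneI.repr.symm (y - x₀) with hz
  have hzr : ‖z‖ = r := by rw [hz, LinearIsometryEquiv.norm_map, ← dist_eq_norm]; exact hy
  refine ⟨z.arg, ⟨(Complex.neg_pi_lt_arg z).le, Complex.arg_le_pi z⟩, ?_⟩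
  have := Complex.norm_mul_exp_arg_mul_I z
  rw [Complex.exp_mul_I, ← Complex.ofReal_cos, ← Complex.ofReal_sin, hzr] at this
  rw [circlePoint, this, hz, LinearIsometryEquiv.apply_symm_apply, add_sub_cancel]

lemma exists_hasDerivAt_circlePoint (x₀ : Euc 2) (r θ : ℝ) :
    ∃ d : Euc 2, ‖d‖ = |r| ∧ HasDerivAt (circlePoint x₀ r) d θ := by
  refine ⟨Complex.orthonormalBasisOneI.repr (r * (-Real.sin θ + Real.cos θ * Complex.I)), ?_, ?_⟩
  · have : (-Real.sin θ + Real.cos θ * Complex.I : ℂ)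
        = (Real.cos θ + Real.sin θ * Complex.I) * Complex.I := by
      linear_combination (-(Real.sin θ : ℂ)) * Complex.I_mul_I
    rw [LinearIsometryEquiv.norm_map, this, norm_mul, norm_mul, norm_cos_add_sin_mul_I,
      Complex.norm_I, Complex.norm_real, Real.norm_eq_abs]
    simp
  · have h1 : HasDerivAt (fun t : ℝ => (r * (Real.cos t + Real.sin t * Complex.I) : ℂ))
        (r * (-Real.sin θ + Real.cos θ * Complex.I)) θ := by
      have hc := (Real.hasDerivAt_cos θ).ofReal_comp
      have hs := (Real.hasDerivAt_sin θ).ofReal_comp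
      simpa using (hc.add (hs.mul_const Complex.I)).const_mul (r : ℂ)
    exact (Complex.orthonormalBasisOneI.repr.toContinuousLinearEquiv.hasFDerivAt.comp_hasDerivAt
      θ h1).const_add x₀

lemma contDiff_circlePoint (x₀ : Euc 2) (r : ℝ) :
    ContDiff ℝ (⊤ : ℕ∞) (circlePoint x₀ r) := by
  have h : ContDiff ℝ (⊤ : ℕ∞)
      (fun t : ℝ => (r * (Real.cos t + Real.sin t * Complex.I) : ℂ)) :=
    contDiff_const.mul ((Complex.ofRealCLM.contDiff.comp Real.contDiff_cos).add
      ((Complex.ofRealCLM.contDiff.comp Real.contDiff_sin).mul contDiff_const))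
  exact contDiff_const.add
    (Complex.orthonormalBasisOneI.repr.toContinuousLinearEquiv.contDiff.comp h)

lemma lintegral_circlePoint_le (x₀ : Euc 2) {a R : ℝ} (ha : 0 ≤ a) {F : Euc 2 → ℝ≥0∞}
    (hF : Measurable F) :
    ∫⁻ r in Ioo a R, ∫⁻ θ in Ioo (-Real.pi) Real.pi, ENNReal.ofReal r * F (circlePoint x₀ r θ)
      ≤ ∫⁻ x in ball x₀ R, F x := by
  set e := Complex.orthonormalBasisOneI.repr
  have hm : Measurable ((ball x₀ R).indicator F) := hF.indicator measurableSet_ball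
  have hP : MeasurePreserving (fun z : ℂ => x₀ + e z) :=
    (measurePreserving_add_left volume x₀).comp e.measurePreserving
  have hc : Measurable fun p : ℝ × ℝ => circlePoint x₀ p.1 p.2 :=
    (continuous_circlePoint x₀).measurable
  calc _ = ∫⁻ p in Ioo a R ×ˢ Ioo (-Real.pi) Real.pi,
          ENNReal.ofReal p.1 * F (circlePoint x₀ p.1 p.2) := by
        rw [Measure.volume_eq_prod, setLIntegral_prod]
        exact ((measurable_fst.ennreal_ofReal).mul (hF.comp hc)).aemeasurable
    _ = ∫⁻ p in Ioo a R ×ˢ Ioo (-Real.pi) Real.pi,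
          ENNReal.ofReal p.1 * (ball x₀ R).indicator F (circlePoint x₀ p.1 p.2) := by
        refine setLIntegral_congr_fun (measurableSet_Ioo.prod measurableSet_Ioo) fun p hp => ?_
        have : circlePoint x₀ p.1 p.2 ∈ ball x₀ R := by
          rw [mem_ball, dist_circlePoint, abs_of_pos (ha.trans_lt hp.1.1)]
          exact hp.1.2
        simp only [indicator_of_mem this]
    _ ≤ ∫⁻ p in polarCoord.target,
          ENNReal.ofReal p.1 • (ball x₀ R).indicator F (x₀ + e (Complex.polarCoord.symm p)) := by
        simp only [Complex.polarCoord_symm_apply]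
        refine lintegral_mono_set ?_
        rw [polarCoord_target]
        exact prod_mono (fun r hr => ha.trans_lt hr.1) subset_rfl
    _ = ∫⁻ z : ℂ, (ball x₀ R).indicator F (x₀ + e z) :=
        Complex.lintegral_comp_polarCoord_symm fun z => (ball x₀ R).indicator F (x₀ + e z)
    _ = ∫⁻ x, (ball x₀ R).indicator F x := hP.lintegral_comp hm
    _ = _ := lintegral_indicator measurableSet_ball _

lemma enorm_sub_le_lintegral_circlePoint {w : Euc 2 → ℝ} (hw : ContDiff ℝ (⊤ : ℕ∞) w)
    {x₀ y z : Euc 2} {r : ℝ} (hy : y ∈ sphere x₀ r) (hz : z ∈ sphere x₀ r) :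
    ‖w y - w z‖ₑ ≤ ∫⁻ θ in Ioo (-Real.pi) Real.pi,
      ENNReal.ofReal r * ‖gradient w (circlePoint x₀ r θ)‖ₑ := by
  have hr : 0 ≤ r := by rw [← mem_sphere.1 hy]; exact dist_nonneg
  have key : ∀ α ∈ Icc (-Real.pi) Real.pi, ∀ β ∈ Icc (-Real.pi) Real.pi, α ≤ β →
      ‖w (circlePoint x₀ r β) - w (circlePoint x₀ r α)‖ₑ ≤ ∫⁻ θ in Ioo (-Real.pi) Real.pi,
        ENNReal.ofReal r * ‖gradient w (circlePoint x₀ r θ)‖ₑ := by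
    intro α hα β hβ hαβ
    refine (enorm_sub_le_lintegral_deriv_of_contDiffOn_Icc
      (f := fun θ => w (circlePoint x₀ r θ))
      ((hw.comp (contDiff_circlePoint x₀ r)).of_le (by simp)).contDiffOn hαβ).trans ?_
    rw [← restrict_Ioo_eq_restrict_Icc]
    refine (lintegral_mono_set (Ioo_subset_Ioo hα.1 hβ.2)).trans (lintegral_mono fun θ => ?_)
    obtain ⟨d, hd, hdd⟩ := exists_hasDerivAt_circlePoint x₀ r θ
    have hwd : HasDerivAt (fun θ => w (circlePoint x₀ r θ))
        (fderiv ℝ w (circlePoint x₀ r θ) d) θ :=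
      ((hw.differentiable (by simp)) _).hasFDerivAt.comp_hasDerivAt θ hdd
    have hg : ‖gradient w (circlePoint x₀ r θ)‖ = ‖fderiv ℝ w (circlePoint x₀ r θ)‖ :=
      LinearIsometryEquiv.norm_map _ _
    beta_reduce
    rw [hwd.deriv, ← ofReal_norm, ← ofReal_norm, ← ENNReal.ofReal_mul hr, hg]
    refine ENNReal.ofReal_le_ofReal ((ContinuousLinearMap.le_opNorm _ _).trans_eq ?_)
    rw [hd, abs_of_nonneg hr, mul_comm]
  obtain ⟨α, hα, rfl⟩ := exists_circlePoint_eq hy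
  obtain ⟨β, hβ, rfl⟩ := exists_circlePoint_eq hz
  rcases le_total α β with h | h
  · rw [enorm_sub_rev]
    exact key α hα β hβ h
  · exact key β hβ α hα h

lemma exists_cluster_of_circle_bound {x₀ : Euc 2} {r D : ℝ} (hr : 0 < r) (hD : 0 < D)
    {w : ℕ → Euc 2 → ℝ} (hw : ∀ j, ContDiff ℝ (⊤ : ℕ∞) (w j)) {l : ℝ≥0} (hl : 0 < l)
    (h : ∃ᶠ j in atTop, ∫⁻ θ in Ioo (-Real.pi) Real.pi, ENNReal.ofReal r *
      (l * ‖w j (circlePoint x₀ r θ)‖ₑ + ‖gradient (w j) (circlePoint x₀ r θ)‖ₑ)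
        < ENNReal.ofReal (D / 2)) :
    ∃ m : ℝ, ∀ δ > 0, ∃ᶠ j in atTop, ∀ x ∈ sphere x₀ r, w j x ∈ Ioo (m - δ) (m + D + δ) := by
  set p := circlePoint x₀ r 0
  have hsph : ∀ θ, circlePoint x₀ r θ ∈ sphere x₀ r := fun θ => by
    rw [mem_sphere, dist_circlePoint, abs_of_pos hr]
  obtain ⟨K, hK⟩ : ∃ K : ℝ, ∀ j, (∫⁻ θ in Ioo (-Real.pi) Real.pi, ENNReal.ofReal r *
      (l * ‖w j (circlePoint x₀ r θ)‖ₑ + ‖gradient (w j) (circlePoint x₀ r θ)‖ₑ)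
        < ENNReal.ofReal (D / 2)) → (∀ x ∈ sphere x₀ r, |w j x - w j p| < D / 2) ∧ |w j p| ≤ K := by
    set V := ENNReal.ofReal r * l * ENNReal.ofReal (2 * Real.pi) with hV
    have hl' : (l : ℝ≥0∞) ≠ 0 := by simpa using hl.ne'
    have hV0 : V ≠ 0 := by
      have := Real.pi_pos
      simp only [hV, ne_eq, mul_eq_zero, not_or, ENNReal.ofReal_eq_zero, not_le]
      exact ⟨⟨hr, hl'⟩, by positivity⟩
    have hVt : V ≠ ∞ := by finiteness
    refine ⟨((ENNReal.ofReal (D / 2) + V * ENNReal.ofReal (D / 2)) / V).toReal, fun j hj => ?_⟩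
    have hosc : ∀ x ∈ sphere x₀ r, ‖w j x - w j p‖ₑ < ENNReal.ofReal (D / 2) := fun x hx =>
      ((enorm_sub_le_lintegral_circlePoint (hw j) hx (hsph 0)).trans
        (lintegral_mono fun θ => by gcongr; exact le_add_self)).trans_lt hj
    refine ⟨fun x hx => ?_, ?_⟩
    · have := hosc x hx
      rwa [← ofReal_norm, ENNReal.ofReal_lt_ofReal_iff (by positivity), Real.norm_eq_abs] at this
    · have hpt : ∀ θ, ‖w j p‖ₑ ≤ ‖w j (circlePoint x₀ r θ)‖ₑ + ENNReal.ofReal (D / 2) := fun θ => by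
        have h1 : w j p = w j (circlePoint x₀ r θ) - (w j (circlePoint x₀ r θ) - w j p) := by ring
        calc ‖w j p‖ₑ = ‖w j (circlePoint x₀ r θ) - (w j (circlePoint x₀ r θ) - w j p)‖ₑ := by
              rw [← h1]
          _ ≤ _ := enorm_sub_le
          _ ≤ _ := by gcongr; exact (hosc _ (hsph θ)).le
      have hc : ∀ c : ℝ≥0∞, ∫⁻ _ in Ioo (-Real.pi) Real.pi, ENNReal.ofReal r * (l * c) = V * c := by
        intro c
        rw [setLIntegral_const, Real.volume_Ioo, hV]
        rw [show Real.pi - -Real.pi = 2 * Real.pi by ring]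
        ring
      have hle : V * ‖w j p‖ₑ ≤ ENNReal.ofReal (D / 2) + V * ENNReal.ofReal (D / 2) := by
        rw [← hc, ← hc]
        calc _ ≤ ∫⁻ θ in Ioo (-Real.pi) Real.pi, (ENNReal.ofReal r *
                (l * ‖w j (circlePoint x₀ r θ)‖ₑ + ‖gradient (w j) (circlePoint x₀ r θ)‖ₑ)
                + ENNReal.ofReal r * (l * ENNReal.ofReal (D / 2))) := by
              refine lintegral_mono fun θ => ?_
              rw [← mul_add]
              gcongr
              calc (l : ℝ≥0∞) * ‖w j p‖ₑ
                  ≤ l * (‖w j (circlePoint x₀ r θ)‖ₑ + ENNReal.ofReal (D / 2)) := by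
                    gcongr; exact hpt θ
                _ = l * ‖w j (circlePoint x₀ r θ)‖ₑ + l * ENNReal.ofReal (D / 2) := mul_add _ _ _
                _ ≤ _ := by gcongr; exact le_self_add
          _ ≤ _ := by
              rw [lintegral_add_right _ measurable_const]
              gcongr
      have hle' : ‖w j p‖ₑ ≤ (ENNReal.ofReal (D / 2) + V * ENNReal.ofReal (D / 2)) / V := by
        rw [ENNReal.le_div_iff_mul_le (.inl hV0) (.inl hVt), mul_comm]
        exact hle
      have := ENNReal.toReal_mono (ENNReal.div_ne_top (by finiteness) hV0) hle'
      simpa using this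
  have hf : ∃ᶠ j in atTop, j ∈ {j | (∀ x ∈ sphere x₀ r, |w j x - w j p| < D / 2) ∧ |w j p| ≤ K} :=
    h.mono hK
  obtain ⟨c, -, hc⟩ := isCompact_Icc.exists_mapClusterPt_of_frequently (s := Icc (-K) K)
    (l := atTop ⊓ 𝓟 {j | (∀ x ∈ sphere x₀ r, |w j x - w j p| < D / 2) ∧ |w j p| ≤ K})
    (f := fun j => w j p)
    (frequently_inf_principal.2 (hf.mono fun j hj => ⟨hj, abs_le.1 hj.2⟩))
  refine ⟨c - D / 2, fun δ hδ => ?_⟩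
  refine (frequently_inf_principal.1 (hc.frequently (Metric.ball_mem_nhds c hδ))).mono ?_
  rintro j ⟨⟨hj, -⟩, hjc⟩ x hx
  rw [Real.dist_eq, abs_lt] at hjc
  have := abs_lt.1 (hj x hx)
  constructor <;> linarith

end circles

section oscillation

lemma exists_frequently_circle_lintegral_lt {x₀ : Euc 2} {R : ℝ} (hR : 0 < R)
    {F : ℕ → Euc 2 → ℝ≥0∞} (hF : ∀ j, Measurable (F j)) {b : ℝ≥0∞}
    (h : liminf (fun j => ∫⁻ x in ball x₀ R, F j x) atTop < b * ENNReal.ofReal (R / 2)) :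
    ∃ r ∈ Ioo (R / 2) R, ∃ᶠ j in atTop, ∫⁻ θ in Ioo (-Real.pi) Real.pi,
      ENNReal.ofReal r * F j (circlePoint x₀ r θ) < b := by
  set G : ℕ → ℝ → ℝ≥0∞ := fun j r => ∫⁻ θ in Ioo (-Real.pi) Real.pi,
    ENNReal.ofReal r * F j (circlePoint x₀ r θ)
  have hG : ∀ j, Measurable (G j) := fun j =>
    Measurable.lintegral_prod_right' (f := fun p : ℝ × ℝ =>
      ENNReal.ofReal p.1 * F j (circlePoint x₀ p.1 p.2))
      ((measurable_fst.ennreal_ofReal).mul ((hF j).comp (continuous_circlePoint x₀).measurable))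
  by_contra! hcon
  refine h.not_ge ?_
  calc b * ENNReal.ofReal (R / 2) = ∫⁻ _ in Ioo (R / 2) R, b := by
        rw [setLIntegral_const, Real.volume_Ioo, _root_.sub_half]
    _ ≤ ∫⁻ r in Ioo (R / 2) R, liminf (fun j => G j r) atTop := by
        refine setLIntegral_mono' measurableSet_Ioo fun r hr => ?_
        exact le_liminf_of_le (h := by
          filter_upwards [hcon r hr] with j hj using hj)
    _ ≤ liminf (fun j => ∫⁻ r in Ioo (R / 2) R, G j r) atTop := lintegral_liminf_le hG
    _ ≤ _ := liminf_le_liminf (.of_forall fun j => lintegral_circlePoint_le x₀ (by positivity) (hF j))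

theorem WeaklyMonotone.exists_ae_mem_Icc {Ω : Set (Euc 2)} (hΩ : IsOpen Ω) {u : Euc 2 → ℝ}
    {g : Euc 2 → Euc 2} (hu : IsWeakGradOn Ω u g) (hg : LocallyIntegrableOn g Ω)
    (hmon : WeaklyMonotone Ω u) {x₀ : Euc 2} {R D : ℝ} (hR : 0 < R) (hD : 0 < D)
    (hB : closedBall x₀ R ⊆ Ω)
    (h : ∫⁻ x in ball x₀ R, ‖g x‖ₑ < ENNReal.ofReal (D / 2) * ENNReal.ofReal (R / 2)) :
    ∃ m : ℝ, ∀ᵐ y ∂volume.restrict (ball x₀ (R / 2)), m ≤ u y ∧ u y ≤ m + D := by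
  obtain ⟨w, hw, hae, h0, h1⟩ := exists_smooth_approx hΩ hu hg hR hB
  have hui : IntegrableOn u (ball x₀ R) :=
    (hu.1.integrableOn_compact_subset hB (isCompact_closedBall _ _)).mono_set ball_subset_closedBall
  have hgi : IntegrableOn g (ball x₀ R) :=
    (hg.integrableOn_compact_subset hB (isCompact_closedBall _ _)).mono_set ball_subset_closedBall
  obtain ⟨l, hl, hlt⟩ := ENNReal.exists_nnreal_pos_mul_lt hui.2.ne (tsub_pos_of_lt h).ne'
  rw [lt_tsub_iff_right] at hlt
  have hlim : liminf (fun j => ∫⁻ x in ball x₀ R, (l * ‖w j x‖ₑ + ‖gradient (w j) x‖ₑ)) atTop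
      < ENNReal.ofReal (D / 2) * ENNReal.ofReal (R / 2) := by
    refine lt_of_le_of_lt ?_ hlt
    have ht : Tendsto (fun j => (l : ℝ≥0∞) * ((∫⁻ x in ball x₀ R, ‖u x‖ₑ)
        + ∫⁻ x in ball x₀ R, ‖w j x - u x‖ₑ) + ((∫⁻ x in ball x₀ R, ‖g x‖ₑ)
        + ∫⁻ x in ball x₀ R, ‖gradient (w j) x - g x‖ₑ)) atTop
        (𝓝 (l * (∫⁻ x in ball x₀ R, ‖u x‖ₑ) + ∫⁻ x in ball x₀ R, ‖g x‖ₑ)) := by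
      have e1 := ENNReal.Tendsto.const_mul (a := (l : ℝ≥0∞))
        (h0.const_add (∫⁻ x in ball x₀ R, ‖u x‖ₑ)) (Or.inr ENNReal.coe_ne_top)
      have e2 := h1.const_add (∫⁻ x in ball x₀ R, ‖g x‖ₑ)
      simpa using e1.add e2
    rw [← ht.liminf_eq]
    refine liminf_le_liminf (.of_forall fun j => ?_)
    beta_reduce
    have hwm : Measurable fun x => ‖w j x‖ₑ := (hw j).continuous.measurable.enorm
    rw [lintegral_add_left (hwm.const_mul _), lintegral_const_mul _ hwm]
    rw [← lintegral_add_left' hui.1.enorm, ← lintegral_add_left' hgi.1.enorm]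
    gcongr with x x
    · simpa using enorm_add_le (u x) (w j x - u x)
    · simpa using enorm_add_le (g x) (gradient (w j) x - g x)
  obtain ⟨r, hr, hfr⟩ := exists_frequently_circle_lintegral_lt hR
    (fun j => ((hw j).continuous.measurable.enorm.const_mul _).add
      (continuous_gradient (hw j)).measurable.enorm) hlim
  have hr0 : 0 < r := (half_pos hR).trans hr.1
  obtain ⟨m, hm⟩ := exists_cluster_of_circle_bound hr0 hD hw hl hfr
  have hsub : ball x₀ r ⊆ ball x₀ R := ball_subset_ball hr.2.le
  have hmem := memW110_truncation (hui.mono_set hsub) (hgi.mono_set hsub) hw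
    (ae_restrict_of_ae_restrict_of_subset hsub hae)
    (tendsto_of_tendsto_of_tendsto_of_le_of_le tendsto_const_nhds h0 (fun _ => bot_le)
      fun j => lintegral_mono_set hsub)
    (tendsto_of_tendsto_of_tendsto_of_le_of_le tendsto_const_nhds h1 (fun _ => bot_le)
      fun j => lintegral_mono_set hsub) (le_add_of_nonneg_right hD.le) hm
  have hcl : closure (ball x₀ r) ⊆ closedBall x₀ r := closure_ball_subset_closedBall
  refine ⟨m, ae_restrict_of_ae_restrict_of_subset (ball_subset_ball hr.1.le)
    (hmon _ isOpen_ball ((isCompact_closedBall x₀ r).of_isClosed_subset isClosed_closure hcl)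
      (hcl.trans ((closedBall_subset_closedBall hr.2.le).trans hB)) m (m + D)
      (le_add_of_nonneg_right hD.le) hmem)⟩

theorem WeaklyMonotone.exists_ae_abs_le {Ω : Set (Euc 2)} (hΩ : IsOpen Ω) {u : Euc 2 → ℝ}
    {g : Euc 2 → Euc 2} (hu : IsWeakGradOn Ω u g) (hg : LocallyIntegrableOn g Ω)
    (hmon : WeaklyMonotone Ω u) {x : Euc 2} (hx : x ∈ Ω) :
    ∃ r > (0 : ℝ), ∃ C : ℝ, ∀ᵐ y ∂volume.restrict (ball x r), |u y| ≤ C := by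
  obtain ⟨R, hR, hB⟩ := nhds_basis_closedBall.mem_iff.1 (hΩ.mem_nhds hx)
  have hgi : IntegrableOn g (ball x R) :=
    (hg.integrableOn_compact_subset hB (isCompact_closedBall _ _)).mono_set ball_subset_closedBall
  set I := (∫⁻ y in ball x R, ‖g y‖ₑ).toReal
  obtain ⟨m, hm⟩ := hmon.exists_ae_mem_Icc hΩ hu hg hR (D := 4 * (I + 1) / R) (by positivity) hB (by
    rw [← ENNReal.ofReal_mul (by positivity), ← ENNReal.ofReal_toReal hgi.2.ne]
    refine (ENNReal.ofReal_lt_ofReal_iff (by positivity)).2 ?_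
    field_simp
    linarith)
  refine ⟨R / 2, half_pos hR, max |m| |m + 4 * (I + 1) / R|, ?_⟩
  filter_upwards [hm] with y hy using abs_le_max_abs_abs hy.1 hy.2

end oscillation

section capacity

lemma capPsi_iUnion_rieszPot_eq_top {n : ℕ} (Ψ : ℝ → ℝ≥0∞) {F : ℕ → Euc n → ℝ≥0∞}
    (hF : ∀ k, Measurable (F k)) (hFi : ∀ k, ∫⁻ x, F k x ≠ ∞) :
    capPsi Ψ (⋃ k, {x | rieszPot Ψ (F k) x = ∞}) = 0 := by
  refine le_antisymm (le_of_forall_gt fun ε hε => ?_) bot_le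
  obtain ⟨ε', hε', hsum⟩ := ENNReal.exists_pos_sum_of_countable hε.ne' ℕ
  set c : ℕ → ℝ≥0∞ := fun k => ε' k / (1 + ∫⁻ x, F k x) with hc
  have hc0 : ∀ k, c k ≠ 0 := fun k =>
    (ENNReal.div_pos (by simpa using (hε' k).ne') (ENNReal.add_ne_top.2 ⟨one_ne_top, hFi k⟩)).ne'
  have hct : ∀ k, c k ≠ ∞ := fun k => ENNReal.div_ne_top coe_ne_top (by simp)
  refine lt_of_le_of_lt (iInf₂_le_of_le (fun x => ∑' k, c k * F k x)
    (Measurable.tsum fun k => (hF k).const_mul _) (iInf_le _ ?_)) (lt_of_le_of_lt ?_ hsum)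
  · intro x hx
    obtain ⟨k, hk⟩ := mem_iUnion.1 hx
    have hle : c k * rieszPot Ψ (F k) x ≤ rieszPot Ψ (fun x => ∑' k, c k * F k x) x := by
      rw [rieszPot, rieszPot, ← lintegral_const_mul' _ _ (hct k)]
      refine lintegral_mono fun y => ?_
      beta_reduce
      rw [← mul_assoc]
      gcongr
      exact ENNReal.le_tsum k
    rw [show rieszPot Ψ (F k) x = ∞ from hk, ENNReal.mul_top (hc0 k)] at hle
    exact le_top.trans hle
  · rw [lintegral_tsum fun k => ((hF k).const_mul _).aemeasurable]
    refine ENNReal.tsum_le_tsum fun k => ?_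
    rw [lintegral_const_mul _ (hF k), hc]
    calc (ε' k / (1 + ∫⁻ x, F k x)) * ∫⁻ x, F k x
        ≤ (ε' k / (1 + ∫⁻ x, F k x)) * (1 + ∫⁻ x, F k x) := by gcongr; exact le_add_self
      _ ≤ ε' k := by rw [mul_comm]; exact ENNReal.mul_div_le

lemma rieszKernel_ofReal (x y : Euc 2) :
    rieszKernel (fun t => ENNReal.ofReal t) x y = (ENNReal.ofReal (dist y x))⁻¹ := by
  rw [rieszKernel, ← ENNReal.ofReal_mul (by positivity), dist_comm, dist_eq_norm]
  congr 2
  rcases eq_or_ne ‖x - y‖ 0 with h | h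
  · simp [h]
  · field_simp

lemma lintegral_ball_le_mul_lintegral_rieszKernel (x : Euc 2) {R : ℝ} (hR : 0 < R)
    (F : Euc 2 → ℝ≥0∞) :
    ∫⁻ y in ball x R, F y ≤ ENNReal.ofReal R *
      ∫⁻ y in ball x R, F y * rieszKernel (fun t => ENNReal.ofReal t) x y := by
  rw [← lintegral_const_mul' _ _ ofReal_ne_top]
  refine setLIntegral_mono' measurableSet_ball fun y hy => ?_
  rw [rieszKernel_ofReal]
  calc F y = ENNReal.ofReal R * (F y * (ENNReal.ofReal R)⁻¹) := by
        rw [mul_left_comm, ENNReal.mul_inv_cancel (by simpa using hR) ofReal_ne_top, mul_one]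
    _ ≤ _ := by
        gcongr
        exact (mem_ball.1 hy).le

lemma tendsto_lintegral_ball_zero {n : ℕ} (hn : 0 < n) {H : Euc n → ℝ≥0∞}
    (hH : ∫⁻ y, H y ≠ ∞) (x : Euc n) :
    Tendsto (fun R => ∫⁻ y in ball x R, H y) (𝓝[>] 0) (𝓝 0) := by
  have : Nonempty (Fin n) := ⟨⟨0, hn⟩⟩
  refine tendsto_setLIntegral_zero hH ?_
  have hv := tendsto_measure_biInter_gt (μ := (volume : Measure (Euc n))) (s := ball x) (a := 0)
    (fun r _ => measurableSet_ball.nullMeasurableSet) (fun i j _ hij => ball_subset_ball hij)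
    ⟨1, one_pos, measure_ball_lt_top.ne⟩
  have hi : ⋂ r > (0 : ℝ), ball x r = {x} := by
    ext y
    simp only [mem_iInter, mem_ball, mem_singleton_iff]
    refine ⟨fun h => dist_le_zero.1 (le_of_forall_gt fun r hr => h r hr), ?_⟩
    rintro rfl r hr
    simpa using hr
  rwa [hi, measure_singleton] at hv

end capacity

section representative

theorem WeaklyMonotone.exists_ae_mem_Icc_of_rieszPot_ne_top {Ω : Set (Euc 2)} (hΩ : IsOpen Ω)
    {u : Euc 2 → ℝ} {g : Euc 2 → Euc 2} (hu : IsWeakGradOn Ω u g) (hg : LocallyIntegrableOn g Ω)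
    (hmon : WeaklyMonotone Ω u) {U : Set (Euc 2)} (hU : IsOpen U) {F : Euc 2 → ℝ≥0∞}
    (hF : ∀ᵐ y ∂volume.restrict (U ∩ Ω), ‖g y‖ₑ ≤ F y) {x : Euc 2} (hxU : x ∈ U) (hxΩ : x ∈ Ω)
    (hx : rieszPot (fun t => ENNReal.ofReal t) F x ≠ ∞) {ε : ℝ} (hε : 0 < ε) :
    ∃ ρ > 0, ball x ρ ⊆ Ω ∧ ∃ m : ℝ, ∀ᵐ y ∂volume.restrict (ball x ρ), m ≤ u y ∧ u y ≤ m + ε := by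
  obtain ⟨R₀, hR₀, hsub⟩ := nhds_basis_closedBall.mem_iff.1 ((hU.inter hΩ).mem_nhds ⟨hxU, hxΩ⟩)
  obtain ⟨R, hlt, hR, hRR⟩ := (((tendsto_lintegral_ball_zero two_pos hx x).eventually_lt_const
    (u := ENNReal.ofReal (ε / 4)) (by simpa using hε)).and
    (Ioo_mem_nhdsGT hR₀)).exists
  have hsubR : closedBall x R ⊆ U ∩ Ω := (closedBall_subset_closedBall hRR.le).trans hsub
  have hb : ball x R ⊆ U ∩ Ω := ball_subset_closedBall.trans hsubR
  obtain ⟨m, hm⟩ := hmon.exists_ae_mem_Icc hΩ hu hg hR hε (hsubR.trans inter_subset_right) (by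
    calc ∫⁻ y in ball x R, ‖g y‖ₑ ≤ ∫⁻ y in ball x R, F y :=
          lintegral_mono_ae (ae_restrict_of_ae_restrict_of_subset hb hF)
      _ ≤ _ := lintegral_ball_le_mul_lintegral_rieszKernel x hR F
      _ < ENNReal.ofReal R * ENNReal.ofReal (ε / 4) := by
          refine ENNReal.mul_lt_mul_right ?_ ofReal_ne_top hlt
          simpa using hR
      _ = _ := by
          rw [← ENNReal.ofReal_mul hR.le, ← ENNReal.ofReal_mul (by positivity)]
          congr 1
          ring)
  exact ⟨R / 2, half_pos hR, (ball_subset_ball (half_le_self hR.le)).trans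
    (hb.trans inter_subset_right), m, hm⟩

/-- The upper limit of the averages of `u` over small balls about `x`. -/
def limsupAverage {n : ℕ} (u : Euc n → ℝ) (x : Euc n) : ℝ :=
  limsup (fun k : ℕ => ⨍ y in closedBall x (1 / ((k : ℝ) + 1)), u y) atTop

lemma limsupAverage_ae_eq {n : ℕ} {Ω : Set (Euc n)} (hΩ : IsOpen Ω) {u : Euc n → ℝ}
    (hu : LocallyIntegrableOn u Ω) : ∀ᵐ x ∂volume.restrict Ω, limsupAverage u x = u x := by
  obtain ⟨U, hUo, hcov, hUi⟩ := hu.exists_nat_integrableOn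
  have hm : ∀ k, MeasurableSet (U k ∩ Ω) := fun k => ((hUo k).inter hΩ).measurableSet
  have hL : ∀ k, LocallyIntegrable ((U k ∩ Ω).indicator u) := fun k =>
    ((integrable_indicator_iff (hm k)).2 (hUi k)).locallyIntegrable
  have hae := ae_all_iff.2 fun k =>
    IsUnifLocDoublingMeasure.ae_tendsto_average (volume : Measure (Euc n)) (hL k) 0
  rw [ae_restrict_iff' hΩ.measurableSet]
  filter_upwards [hae] with x hx hxΩ
  obtain ⟨k, hk⟩ := mem_iUnion.1 (hcov hxΩ)
  have ht : Tendsto (fun j : ℕ => 1 / ((j : ℝ) + 1)) atTop (𝓝[>] 0) :=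
    tendsto_nhdsWithin_iff.2 ⟨tendsto_one_div_add_atTop_nhds_zero_nat,
      .of_forall fun j => by simp only [mem_Ioi]; positivity⟩
  have h := hx k (fun _ => x) _ ht (.of_forall fun j => by simp)
  rw [indicator_of_mem (show x ∈ U k ∩ Ω from ⟨hk, hxΩ⟩)] at h
  refine Tendsto.limsup_eq (h.congr' ?_)
  filter_upwards [tendsto_one_div_add_atTop_nhds_zero_nat.eventually
    (eventually_closedBall_subset (((hUo k).inter hΩ).mem_nhds ⟨hk, hxΩ⟩))] with j hj
  exact setAverage_congr_fun measurableSet_closedBall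
    (.of_forall fun y hy => indicator_of_mem (hj hy) u)

lemma limsupAverage_mem_Icc {n : ℕ} {V : Set (Euc n)} (hV : IsOpen V) {u : Euc n → ℝ}
    (hu : LocallyIntegrableOn u V) {m M : ℝ}
    (h : ∀ᵐ y ∂volume.restrict V, m ≤ u y ∧ u y ≤ M) {x : Euc n} (hx : x ∈ V) :
    limsupAverage u x ∈ Icc m M := by
  have hev : ∀ᶠ k : ℕ in atTop, (⨍ y in closedBall x (1 / ((k : ℝ) + 1)), u y) ∈ Icc m M := by
    filter_upwards [tendsto_one_div_add_atTop_nhds_zero_nat.eventually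
      (eventually_closedBall_subset (hV.mem_nhds hx))] with k hk
    exact (convex_Icc m M).set_average_mem isClosed_Icc
      (measure_closedBall_pos _ _ (by positivity)).ne' measure_closedBall_lt_top.ne
      (ae_restrict_of_ae_restrict_of_subset hk h)
      (hu.integrableOn_compact_subset hk (isCompact_closedBall _ _))
  have hbdd : IsBoundedUnder (· ≤ ·) atTop
      fun k : ℕ => ⨍ y in closedBall x (1 / ((k : ℝ) + 1)), u y :=
    isBoundedUnder_of_eventually_le (hev.mono fun k hk => hk.2)
  have hbdd' : IsBoundedUnder (· ≥ ·) atTop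
      fun k : ℕ => ⨍ y in closedBall x (1 / ((k : ℝ) + 1)), u y :=
    isBoundedUnder_of_eventually_ge (hev.mono fun k hk => hk.1)
  exact ⟨le_limsup_of_frequently_le (hev.mono fun k hk => hk.1).frequently hbdd,
    limsup_le_of_le hbdd'.isCoboundedUnder_le (hev.mono fun k hk => hk.2)⟩

lemma continuousAt_limsupAverage {n : ℕ} {Ω : Set (Euc n)} {u : Euc n → ℝ}
    (hu : LocallyIntegrableOn u Ω) {x : Euc n}
    (h : ∀ ε > 0, ∃ ρ > 0, ball x ρ ⊆ Ω ∧
      ∃ m : ℝ, ∀ᵐ y ∂volume.restrict (ball x ρ), m ≤ u y ∧ u y ≤ m + ε) :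
    ContinuousAt (limsupAverage u) x := by
  refine Metric.continuousAt_iff'.2 fun ε hε => ?_
  obtain ⟨ρ, hρ, hsub, m, hm⟩ := h (ε / 2) (half_pos hε)
  have hmem := fun y hy => limsupAverage_mem_Icc (x := y) isOpen_ball (hu.mono_set hsub) hm hy
  filter_upwards [ball_mem_nhds x hρ] with y hy
  have h1 := hmem y hy
  have h2 := hmem x (mem_ball_self hρ)
  rw [Real.dist_eq, abs_lt]
  constructor <;> linarith [h1.1, h1.2, h2.1, h2.2]

end representative

theorem weaklyMonotone_W11_dim2 (Ω : Set (Euc 2)) (hΩ : IsOpen Ω)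
    (u : Euc 2 → ℝ) (g : Euc 2 → Euc 2)
    (hu : IsWeakGradOn Ω u g) (hmon : WeaklyMonotone Ω u) :
    (∀ x ∈ Ω, ∃ r > (0 : ℝ), ∃ Cb : ℝ,
        ∀ᵐ y ∂volume.restrict (ball x r), |u y| ≤ Cb) ∧
      ∃ v : Euc 2 → ℝ, (∀ᵐ x ∂volume.restrict Ω, v x = u x) ∧
        ∃ S : Set (Euc 2),
          capPsi (fun t => ENNReal.ofReal t) S = 0 ∧ ContinuousOn v (Ω \ S) := by
  obtain ⟨g', hg', hu'⟩ := hu.exists_locallyIntegrableOn hΩ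
  refine ⟨fun x hx => hmon.exists_ae_abs_le hΩ hu' hg' hx, limsupAverage u,
    limsupAverage_ae_eq hΩ hu.1, ?_⟩
  obtain ⟨U, hUo, hcov, hUi⟩ := hg'.exists_nat_integrableOn
  have hm : ∀ k, AEMeasurable (fun y => ‖g' y‖ₑ) (volume.restrict (U k ∩ Ω)) :=
    fun k => (hUi k).1.enorm
  set F : ℕ → Euc 2 → ℝ≥0∞ := fun k => (U k ∩ Ω).indicator ((hm k).mk _)
  have hms : ∀ k, MeasurableSet (U k ∩ Ω) := fun k => ((hUo k).inter hΩ).measurableSet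
  refine ⟨⋃ k, {x | rieszPot (fun t => ENNReal.ofReal t) (F k) x = ∞},
    capPsi_iUnion_rieszPot_eq_top _ (fun k => (hm k).measurable_mk.indicator (hms k)) fun k => ?_,
    fun x hx => (continuousAt_limsupAverage hu.1 fun ε hε => ?_).continuousWithinAt⟩
  · rw [lintegral_indicator (hms k), ← lintegral_congr_ae (hm k).ae_eq_mk]
    exact (hUi k).2.ne
  · obtain ⟨k, hk⟩ := mem_iUnion.1 (hcov hx.1)
    refine hmon.exists_ae_mem_Icc_of_rieszPot_ne_top hΩ hu' hg' (hUo k) (F := F k) ?_ hk hx.1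
      (fun h => hx.2 (mem_iUnion.2 ⟨k, h⟩)) hε
    filter_upwards [(hm k).ae_eq_mk, ae_restrict_mem (hms k)] with y hy hyU
    exact (hy.trans (indicator_of_mem hyU _).symm).le
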